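/- arXiv:1408.6046 — 2 statements merged into one kernel-verified Lean document; each statement's English description precedes it below -/
import Mathlib

section
/- If a graph G of order at least 6 satisfies (|V(G)|+1)/3 ≤ Δ(G) < |V(G)|/2 and no component of G is K_{Δ(G)+1}, then every maximal [r,s,t]-coloring of G satisfies r+s+t ≤ Δ(G). -/
open Finset

variable {V : Type*}

/-- `P` is the set of color classes of an `[r,s,t]`-coloring of `G`:
a partition of the vertices into independent sets, with `r` classes of size 3,
`s` classes of size 2 and `t` singleton classes. -/
def IsRST [Fintype V] [DecidableEq V] (G : SimpleGraph V) (P : Finset (Finset V))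
    (r s t : ℕ) : Prop :=
  (∀ v : V, ∃! A, A ∈ P ∧ v ∈ A) ∧
  (∀ A ∈ P, ∀ u ∈ A, ∀ w ∈ A, ¬ G.Adj u w) ∧
  (P.filter (fun A => A.card = 3)).card = r ∧
  (P.filter (fun A => A.card = 2)).card = s ∧
  (P.filter (fun A => A.card = 1)).card = t ∧
  (∀ A ∈ P, A.card = 1 ∨ A.card = 2 ∨ A.card = 3)

/-- A maximal `[r,s,t]`-coloring: for any other `[r',s',t']`-coloring,
either `r > r'`, or `r = r'` and `s ≥ s'`. -/
def IsMaxRST [Fintype V] [DecidableEq V] (G : SimpleGraph V) (P : Finset (Finset V))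
    (r s t : ℕ) : Prop :=
  IsRST G P r s t ∧
  ∀ (P' : Finset (Finset V)) (r' s' t' : ℕ), IsRST G P' r' s' t' →
    r' < r ∨ (r' = r ∧ s' ≤ s)

/-- `eB G X Y` is the number of edges with one endpoint in `X` and the other in `Y`. -/
def eB [Fintype V] [DecidableEq V] (G : SimpleGraph V) [DecidableRel G.Adj]
    (X Y : Finset V) : ℕ :=
  ((X ×ˢ Y).filter fun p => G.Adj p.1 p.2).card

/-- `G` is equitably `k`-colorable: a proper `k`-coloring whose color classes
have sizes differing pairwise by at most 1. -/
def EqColorable [Fintype V] (G : SimpleGraph V) (k : ℕ) : Prop :=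
  ∃ C : V → Fin k, (∀ u v, G.Adj u v → C u ≠ C v) ∧
    ∀ i j : Fin k,
      (Finset.univ.filter fun v => C v = i).card ≤
        (Finset.univ.filter fun v => C v = j).card + 1

/-- constraints coming from the absence of gains -/
def phi (xa xb xc ya yb yc ua ub uc va vb vc : Bool) : Bool :=
  ((xa || ya) || ((ub || uc) && (vb || vc) && (ub || vb) && (uc || vc))) &&
  ((xb || yb) || ((ua || uc) && (va || vc) && (ua || va) && (uc || vc))) &&
  ((xc || yc) || ((ua || ub) && (va || vb) && (ua || va) && (ub || vb)))

theorem phi_sum : ∀ xa xb xc ya yb yc ua ub uc va vb vc : Bool,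
  phi xa xb xc ya yb yc ua ub uc va vb vc = true →
  phi ua ub uc va vb vc xa xb xc ya yb yc = true →
  4 ≤ (xa.toNat + xb.toNat + xc.toNat) + (ya.toNat + yb.toNat + yc.toNat) + 
   ((ua.toNat + ub.toNat + uc.toNat) + (va.toNat + vb.toNat + vc.toNat)) := by
  decide +kernel

theorem phi_re : ∀ xa xb xc ya yb yc ua ub uc va vb vc : Bool,
  phi xa xb xc ya yb yc ua ub uc va vb vc = true →
  phi ua ub uc va vb vc xa xb xc ya yb yc = true →
  phi xa xb xc va vb vc ua ub uc ya yb yc = true →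
  phi ua ub uc ya yb yc xa xb xc va vb vc = true →
  (xa.toNat + xb.toNat + xc.toNat) + (ya.toNat + yb.toNat + yc.toNat) + 
   ((ua.toNat + ub.toNat + uc.toNat) + (va.toNat + vb.toNat + vc.toNat)) = 4 →
  (xa.toNat + xb.toNat + xc.toNat) + (ua.toNat + ub.toNat + uc.toNat) = 2 := by
  decide +kernel

theorem phi_two : ∀ xa xb xc ya yb yc ua ub uc va vb vc : Bool,
  phi xa xb xc ya yb yc ua ub uc va vb vc = true →
  phi ua ub uc va vb vc xa xb xc ya yb yc = true →
  (xa.toNat + xb.toNat + xc.toNat) + (ya.toNat + yb.toNat + yc.toNat) = 2 → 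
   ((ua.toNat + ub.toNat + uc.toNat) + (va.toNat + vb.toNat + vc.toNat)) = 2 →
  (xa.toNat + xb.toNat + xc.toNat) = 1 ∧ 
  (xa.toNat + ya.toNat ≤ 1 ∧ xb.toNat + yb.toNat ≤ 1 ∧ xc.toNat + yc.toNat ≤ 1) ∧
  (xa.toNat + ya.toNat = ua.toNat + va.toNat ∧ xb.toNat + yb.toNat = ub.toNat + vb.toNat ∧ xc.toNat + yc.toNat = uc.toNat + vc.toNat) ∧
  (xa.toNat + ya.toNat = 0 ∨ xb.toNat + yb.toNat = 0 ∨ xc.toNat + yc.toNat = 0)  := by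
  decide +kernel

set_option linter.unusedSectionVars false

section helpers
variable [Fintype V] [DecidableEq V]

def wt (G : SimpleGraph V) [DecidableRel G.Adj] (u v : V) : ℕ := (decide (G.Adj u v)).toNat

def ee (G : SimpleGraph V) [DecidableRel G.Adj] (v : V) (A : Finset V) : ℕ := ∑ a ∈ A, wt G v a

def Ind (G : SimpleGraph V) (A : Finset V) : Prop := ∀ u ∈ A, ∀ v ∈ A, ¬ G.Adj u v

def Conf (G : SimpleGraph V) (C : Finset (Finset V)) : Prop :=
  (∀ A ∈ C, (A.card = 2 ∨ A.card = 3) ∧ Ind G A) ∧ ∀ A ∈ C, ∀ B ∈ C, A ≠ B → Disjoint A B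

def c3 (C : Finset (Finset V)) : ℕ := (C.filter (fun A => A.card = 3)).card
def c2 (C : Finset (Finset V)) : ℕ := (C.filter (fun A => A.card = 2)).card

def US (C : Finset (Finset V)) : Finset V := univ.filter (fun v => ∀ A ∈ C, v ∉ A)

def Mx (G : SimpleGraph V) (r s : ℕ) (C : Finset (Finset V)) : Prop :=
  Conf G C ∧ c3 C = r ∧ c2 C = s ∧
    ∀ C', Conf G C' → c3 C' < r ∨ (c3 C' = r ∧ c2 C' ≤ s)

variable {G : SimpleGraph V} [DecidableRel G.Adj] {r s : ℕ} {C : Finset (Finset V)}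

theorem wt_le (u v : V) : wt G u v ≤ 1 := by unfold wt; exact Bool.toNat_le _

theorem wt_comm (u v : V) : wt G u v = wt G v u := by unfold wt; simp [G.adj_comm]

theorem wt_one {u v : V} : wt G u v = 1 ↔ G.Adj u v := by unfold wt; simp [Bool.toNat_eq_one]

theorem wt_zero {u v : V} : wt G u v = 0 ↔ ¬ G.Adj u v := by unfold wt; simp [Bool.toNat_eq_zero]

theorem ee_pos {v : V} {A : Finset V} : 1 ≤ ee G v A ↔ ∃ a ∈ A, G.Adj v a := by
  constructor
  · intro h
    by_contra hc
    push Not at hc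
    have : ee G v A = 0 := Finset.sum_eq_zero fun a ha => wt_zero.2 (hc a ha)
    omega
  · rintro ⟨a, ha, h⟩
    have : wt G v a ≤ ee G v A := Finset.single_le_sum (f := fun a => wt G v a) (fun _ _ => Nat.zero_le _) ha
    rw [wt_one.2 h] at this
    exact this

theorem ee_zero {v : V} {A : Finset V} : ee G v A = 0 ↔ ∀ a ∈ A, ¬ G.Adj v a := by
  have := ee_pos (G := G) (v := v) (A := A)
  constructor
  · intro h a ha hv
    have := this.2 ⟨a, ha, hv⟩
    omega
  · intro h
    by_contra hc
    obtain ⟨a, ha, hv⟩ := this.1 (by omega)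
    exact h a ha hv

theorem ee_uniq {v : V} {A : Finset V} (h : ee G v A ≤ 1) {a b : V} (ha : a ∈ A) (hb : b ∈ A)
    (h1 : G.Adj v a) (h2 : G.Adj v b) : a = b := by
  by_contra hne
  have h3 : ∑ x ∈ ({a, b} : Finset V), wt G v x ≤ ∑ x ∈ A, wt G v x :=
    Finset.sum_le_sum_of_subset (by intro x; simp; rintro (rfl | rfl) <;> assumption)
  rw [Finset.sum_pair hne, wt_one.2 h1, wt_one.2 h2] at h3
  unfold ee at h
  omega

theorem ee_insert {v a : V} {A : Finset V} (h : a ∉ A) : ee G v (insert a A) = wt G v a + ee G v A := by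
  unfold ee; rw [Finset.sum_insert h]

theorem ee_pair {v a b : V} (h : a ≠ b) : ee G v {a, b} = wt G v a + wt G v b := by
  unfold ee; rw [Finset.sum_pair h]

theorem mem_US {v : V} : v ∈ US C ↔ ∀ A ∈ C, v ∉ A := by simp [US]

theorem union_eq (C : Finset (Finset V)) : (univ : Finset V) = C.biUnion id ∪ US C := by
  ext v
  simp only [Finset.mem_univ, true_iff, Finset.mem_union, Finset.mem_biUnion, mem_US, id]
  by_contra h
  push Not at h
  grind

theorem sum_split (hC : Conf G C) (f : V → ℕ) :
    ∑ v, f v = ∑ A ∈ C, ∑ v ∈ A, f v + ∑ v ∈ US C, f v := by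
  rw [union_eq C, Finset.sum_union, Finset.sum_biUnion]
  · rfl
  · intro A hA B hB hne
    exact hC.2 A hA B hB hne
  · rw [Finset.disjoint_left]
    intro v hv
    simp only [Finset.mem_biUnion, id] at hv
    obtain ⟨A, hA, hv⟩ := hv
    rw [mem_US]
    intro h
    exact h A hA hv

theorem deg_eq (hC : Conf G C) (v : V) : G.degree v = ∑ A ∈ C, ee G v A + ee G v (US C) := by
  have := sum_split hC (fun x => wt G v x)
  unfold ee
  rw [← this, ← G.card_neighborFinset_eq_degree, Finset.card_eq_sum_ones, G.neighborFinset_eq_filter,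
    Finset.sum_filter]
  refine Finset.sum_congr rfl fun x _ => ?_
  by_cases h : G.Adj v x
  · simp [h, wt_one.2 h]
  · simp [h, wt_zero.2 h]

theorem card_C (hC : Conf G C) : C.card = c3 C + c2 C := by
  unfold c3 c2
  rw [← Finset.card_union_of_disjoint]
  · congr 1
    ext A
    simp only [Finset.mem_union, Finset.mem_filter]
    have := hC.1 A
    tauto
  · rw [Finset.disjoint_left]
    intro A
    simp only [Finset.mem_filter]
    omega

theorem card_V (hC : Conf G C) : Fintype.card V = 3 * c3 C + 2 * c2 C + (US C).card := by
  have := sum_split hC (fun _ => 1)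
  simp only [Finset.sum_const, smul_eq_mul, mul_one, Finset.card_univ] at this
  rw [this]
  congr 1
  have h : ∀ A ∈ C, A.card = (if A.card = 3 then 3 else 0) + (if A.card = 2 then 2 else 0) := by
    intro A hA
    rcases (hC.1 A hA).1 with h | h <;> simp [h]
  rw [Finset.sum_congr rfl h, Finset.sum_add_distrib, ← Finset.sum_filter, ← Finset.sum_filter]
  simp only [Finset.sum_const, smul_eq_mul, c3, c2]
  ring

/-! gains -/
theorem gain (hM : Mx G r s C) (D : Finset (Finset V)) (hD : Conf G D) : c3 D ≤ r := by
  rcases hM.2.2.2 D hD with h | h <;> omega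

theorem gain0 (hM : Mx G r s C) (T : Finset V) (hT : T.card = 3) (hi : Ind G T)
    (hd : ∀ A ∈ C, A.card = 3 → Disjoint T A) : False := by
  have hn : T ∉ C.filter (fun A => A.card = 3) := by
    intro h
    rw [Finset.mem_filter] at h
    have := hd T h.1 h.2
    rw [disjoint_self] at this
    rw [this] at hT
    simp at hT
  have h := gain hM (insert T (C.filter (fun A => A.card = 3))) ⟨by
    intro A hA
    rw [Finset.mem_insert, Finset.mem_filter] at hA
    rcases hA with rfl | hA
    · exact ⟨Or.inr hT, hi⟩
    · exact hM.1.1 A hA.1, by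
    intro A hA B hB hne
    rw [Finset.mem_insert, Finset.mem_filter] at hA hB
    rcases hA with rfl | hA <;> rcases hB with rfl | hB
    · exact absurd rfl hne
    · exact hd B hB.1 hB.2
    · exact (hd A hA.1 hA.2).symm
    · exact hM.1.2 A hA.1 B hB.1 hne⟩
  have h3 := hM.2.1
  unfold c3 at h h3
  rw [Finset.filter_insert, if_pos hT, Finset.card_insert_of_notMem, Finset.filter_filter] at h
  · simp only [and_self] at h
    omega
  · simpa using hn

theorem gain1 (hM : Mx G r s C) {A : Finset V} (hA : A ∈ C) (T T' : Finset V) (hT : T.card = 3) (hi : Ind G T)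
    (hT' : T'.card = 3) (hi' : Ind G T') (hTT : Disjoint T T')
    (hd : ∀ B ∈ C, B.card = 3 → B ≠ A → Disjoint T B ∧ Disjoint T' B) : False := by
  have key : ∀ T : Finset V, T.card = 3 → (∀ B ∈ C, B.card = 3 → B ≠ A → Disjoint T B) → T ∉ (C.filter (fun A => A.card = 3)).erase A := by
    intro T hT hd h
    rw [Finset.mem_erase, Finset.mem_filter] at h
    have := hd T h.2.1 h.2.2 h.1
    rw [disjoint_self] at this
    rw [this] at hT
    simp at hT
  have hne : T ≠ T' := by
    rintro rfl
    rw [disjoint_self] at hTT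
    rw [hTT] at hT
    simp at hT
  have h := gain hM (insert T (insert T' ((C.filter (fun A => A.card = 3)).erase A))) ⟨by
    intro B hB
    rw [Finset.mem_insert, Finset.mem_insert, Finset.mem_erase, Finset.mem_filter] at hB
    rcases hB with rfl | rfl | hB
    · exact ⟨Or.inr hT, hi⟩
    · exact ⟨Or.inr hT', hi'⟩
    · exact hM.1.1 B hB.2.1, by
    intro B hB D hD hne2
    rw [Finset.mem_insert, Finset.mem_insert, Finset.mem_erase, Finset.mem_filter] at hB hD
    rcases hB with rfl | rfl | hB <;> rcases hD with rfl | rfl | hD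
    · exact absurd rfl hne2
    · exact hTT
    · exact (hd D hD.2.1 hD.2.2 hD.1).1
    · exact hTT.symm
    · exact absurd rfl hne2
    · exact (hd D hD.2.1 hD.2.2 hD.1).2
    · exact (hd B hB.2.1 hB.2.2 hB.1).1.symm
    · exact (hd B hB.2.1 hB.2.2 hB.1).2.symm
    · exact hM.1.2 B hB.2.1 D hD.2.1 hne2⟩
  have h3 := hM.2.1
  have e : (insert T (insert T' ((C.filter (fun A => A.card = 3)).erase A))).filter (fun A => A.card = 3)
     = (insert T (insert T' ((C.filter (fun A => A.card = 3)).erase A))) := by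
    apply Finset.filter_true_of_mem
    intro B hB
    rw [Finset.mem_insert, Finset.mem_insert, Finset.mem_erase, Finset.mem_filter] at hB
    rcases hB with rfl | rfl | hB
    · exact hT
    · exact hT'
    · exact hB.2.2
  have k1 := key T hT (fun B h1 h2 h3 => (hd B h1 h2 h3).1)
  have k2 := key T' hT' (fun B h1 h2 h3 => (hd B h1 h2 h3).2)
  have := Finset.pred_card_le_card_erase (a := A) (s := C.filter (fun A => A.card = 3))
  unfold c3 at h h3
  rw [e, Finset.card_insert_of_notMem (by rw [Finset.mem_insert]; tauto), Finset.card_insert_of_notMem k2] at h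
  omega

theorem US_clique (hM : Mx G r s C) {u v : V} (hu : u ∈ US C) (hv : v ∈ US C) (hne : u ≠ v) : G.Adj u v := by
  by_contra hadj
  rw [mem_US] at hu hv
  have hcard : ({u, v} : Finset V).card = 2 := Finset.card_pair hne
  have hn : ({u, v} : Finset V) ∉ C := fun h => hu _ h (by simp)
  have hdis : ∀ A ∈ C, Disjoint {u, v} A := by
    intro A hA
    rw [Finset.disjoint_left]
    intro x hx
    simp only [Finset.mem_insert, Finset.mem_singleton] at hx
    rcases hx with rfl | rfl
    · exact hu A hA
    · exact hv A hA
  have h := hM.2.2.2 (insert {u, v} C) ⟨by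
    intro A hA
    rw [Finset.mem_insert] at hA
    rcases hA with rfl | hA
    · refine ⟨Or.inl hcard, ?_⟩
      intro x hx y hy
      simp only [Finset.mem_insert, Finset.mem_singleton] at hx hy
      rcases hx with rfl | rfl <;> rcases hy with rfl | rfl <;> simp_all [G.adj_comm]
    · exact hM.1.1 A hA, by
    intro A hA B hB hne
    rw [Finset.mem_insert] at hA hB
    rcases hA with rfl | hA <;> rcases hB with rfl | hB
    · exact absurd rfl hne
    · exact hdis B hB
    · exact (hdis A hA).symm
    · exact hM.1.2 A hA B hB hne⟩
  have h3 := hM.2.1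
  have h2 := hM.2.2.1
  unfold c3 c2 at *
  rw [Finset.filter_insert, if_neg (by omega), Finset.filter_insert, if_pos hcard,
    Finset.card_insert_of_notMem (by simp [hn])] at h
  omega

theorem ex2 (hM : Mx G r s C) {A B A' B' : Finset V} (hA : A ∈ C) (hB : B ∈ C) (hne : A ≠ B)
    (cA : A'.card = A.card) (cB : B'.card = B.card) (iA : Ind G A') (iB : Ind G B')
    (hd : Disjoint A' B') (hdd : ∀ Q ∈ C, Q ≠ A → Q ≠ B → Disjoint A' Q ∧ Disjoint B' Q) :
    Mx G r s (insert A' (insert B' ((C.erase A).erase B))) := by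
  have nz : ∀ Q : Finset V, (Q.card = 2 ∨ Q.card = 3) → Disjoint Q Q → False := by
    intro Q h h'
    rw [disjoint_self] at h'
    rw [h'] at h
    simp at h
  have hcA := (hM.1.1 A hA).1
  have hcB := (hM.1.1 B hB).1
  have n2 : B' ∉ (C.erase A).erase B := by
    intro h
    rw [Finset.mem_erase, Finset.mem_erase] at h
    exact nz B' (by rw [cB]; exact hcB) (hdd B' h.2.2 h.2.1 h.1).2
  have n1 : A' ∉ insert B' ((C.erase A).erase B) := by
    intro h
    rw [Finset.mem_insert, Finset.mem_erase, Finset.mem_erase] at h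
    rcases h with rfl | h
    · exact nz A' (by rw [cA]; exact hcA) hd
    · exact nz A' (by rw [cA]; exact hcA) (hdd A' h.2.2 h.2.1 h.1).1
  have cnt : ∀ k, ((insert A' (insert B' ((C.erase A).erase B))).filter (fun Q => Q.card = k)).card
      = (C.filter (fun Q => Q.card = k)).card := by
    intro k
    have hC : C = insert A (insert B ((C.erase A).erase B)) := by
      ext Q; simp only [Finset.mem_insert, Finset.mem_erase]; grind
    rw [Finset.card_filter, Finset.card_filter]
    conv_rhs => rw [hC]
    rw [Finset.sum_insert n1, Finset.sum_insert n2, Finset.sum_insert, Finset.sum_insert, cA, cB]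
    · simp
    · simp [hne]
  refine ⟨⟨?_, ?_⟩, ?_, ?_, hM.2.2.2⟩
  · intro Q hQ
    rw [Finset.mem_insert, Finset.mem_insert, Finset.mem_erase, Finset.mem_erase] at hQ
    rcases hQ with rfl | rfl | hQ
    · rw [cA]; exact ⟨hcA, iA⟩
    · rw [cB]; exact ⟨hcB, iB⟩
    · exact hM.1.1 Q hQ.2.2
  · intro Q hQ R hR hne
    rw [Finset.mem_insert, Finset.mem_insert, Finset.mem_erase, Finset.mem_erase] at hQ hR
    rcases hQ with rfl | rfl | hQ <;> rcases hR with rfl | rfl | hR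
    · exact absurd rfl hne
    · exact hd
    · exact (hdd R hR.2.2 hR.2.1 hR.1).1
    · exact hd.symm
    · exact absurd rfl hne
    · exact (hdd R hR.2.2 hR.2.1 hR.1).2
    · exact (hdd Q hQ.2.2 hQ.2.1 hQ.1).1.symm
    · exact (hdd Q hQ.2.2 hQ.2.1 hQ.1).2.symm
    · exact hM.1.2 Q hQ.2.2 R hR.2.2 hne
  · unfold c3; rw [cnt]; exact hM.2.1
  · unfold c2; rw [cnt]; exact hM.2.2.1

/-- single exchange -/
theorem ex1 (hM : Mx G r s C) {A : Finset V} {u a : V} (hA : A ∈ C) (ha : a ∈ A) (hu : u ∈ US C)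
    (hi : ∀ x ∈ A, x ≠ a → ¬ G.Adj u x) :
    ∃ C', Mx G r s C' ∧ insert u (A.erase a) ∈ C' ∧ US C' = insert a ((US C).erase u) ∧
      ∀ Q ∈ C, Q ≠ A → Q ∈ C' := by
  have huA : u ∉ A := mem_US.1 hu A hA
  have huQ := mem_US.1 hu
  set A' := insert u (A.erase a) with hA'
  have cA : A'.card = A.card := by
    rw [hA', Finset.card_insert_of_notMem (by simp [huA]), Finset.card_erase_of_mem ha]
    have := Finset.card_pos.2 ⟨a, ha⟩
    omega
  have iA : Ind G A' := by
    intro x hx y hy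
    have := (hM.1.1 A hA).2
    unfold Ind at this
    rw [hA', Finset.mem_insert, Finset.mem_erase] at hx hy
    rcases hx with rfl | hx <;> rcases hy with rfl | hy
    · exact G.irrefl
    · exact hi y hy.2 hy.1
    · rw [G.adj_comm]; exact hi x hx.2 hx.1
    · exact this x hx.2 y hy.2
  have hd : ∀ Q ∈ C, Q ≠ A → Disjoint A' Q := by
    intro Q hQ hne
    rw [hA', Finset.disjoint_insert_left]
    exact ⟨huQ Q hQ, (hM.1.2 A hA Q hQ hne.symm).mono_left (Finset.erase_subset _ _)⟩
  have n1 : A' ∉ C.erase A := by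
    intro h
    rw [Finset.mem_erase] at h
    exact huQ A' h.2 (by simp [hA'])
  have cnt : ∀ k, ((insert A' (C.erase A)).filter (fun Q => Q.card = k)).card
      = (C.filter (fun Q => Q.card = k)).card := by
    intro k
    have hC : C = insert A (C.erase A) := (Finset.insert_erase hA).symm
    rw [Finset.card_filter, Finset.card_filter]
    conv_rhs => rw [hC]
    rw [Finset.sum_insert n1, Finset.sum_insert (by simp), cA]
  refine ⟨insert A' (C.erase A), ⟨⟨?_, ?_⟩, ?_, ?_, hM.2.2.2⟩, by simp, ?_, ?_⟩
  · intro Q hQ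
    rw [Finset.mem_insert, Finset.mem_erase] at hQ
    rcases hQ with rfl | hQ
    · rw [cA]; exact ⟨(hM.1.1 A hA).1, iA⟩
    · exact hM.1.1 Q hQ.2
  · intro Q hQ R hR hne
    rw [Finset.mem_insert, Finset.mem_erase] at hQ hR
    rcases hQ with rfl | hQ <;> rcases hR with rfl | hR
    · exact absurd rfl hne
    · exact hd R hR.2 hR.1
    · exact (hd Q hQ.2 hQ.1).symm
    · exact hM.1.2 Q hQ.2 R hR.2 hne
  · unfold c3; rw [cnt]; exact hM.2.1
  · unfold c2; rw [cnt]; exact hM.2.2.1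
  · have hdj := hM.1.2
    ext v
    simp only [mem_US, Finset.mem_insert, Finset.mem_erase]
    constructor
    · intro h
      by_cases hva : v = a
      · exact Or.inl hva
      · refine Or.inr ⟨?_, ?_⟩
        · rintro rfl
          exact h A' (Or.inl rfl) (by simp [hA'])
        · intro Q hQ
          by_cases hQA : Q = A
          · subst hQA
            intro hv
            exact h A' (Or.inl rfl) (by simp [hA', hva, hv])
          · exact h Q (Or.inr ⟨hQA, hQ⟩)
    · rintro (rfl | ⟨h1, h2⟩) Q (rfl | hQ)
      · rw [hA', Finset.mem_insert, Finset.mem_erase]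
        rintro (rfl | h)
        · exact huA ha
        · exact h.1 rfl
      · intro hv
        exact Finset.disjoint_left.1 (hdj A hA Q hQ.2 hQ.1.symm) ha hv
      · rw [hA', Finset.mem_insert, Finset.mem_erase]
        rintro (rfl | h)
        · exact h1 rfl
        · exact h2 A hA h.2
      · exact h2 Q hQ.2
  · intro Q hQ hne
    simp [hQ, hne]

def NT (C : Finset (Finset V)) (v : V) : Prop := ∀ A ∈ C, A.card = 3 → v ∉ A

theorem NT_US {v : V} (hv : v ∈ US C) : NT C v := fun A hA _ => mem_US.1 hv A hA

theorem NT_pair (hC : Conf G C) {B : Finset V} (hB : B ∈ C) (h2 : B.card = 2) {v : V} (hv : v ∈ B) :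
    NT C v := by
  intro A hA h3 hvA
  have hne : A ≠ B := by rintro rfl; omega
  exact Finset.disjoint_left.1 (hC.2 A hA B hB hne) hvA hv

theorem cls_uniq (hC : Conf G C) {A B : Finset V} (hA : A ∈ C) (hB : B ∈ C) {v : V} (h1 : v ∈ A)
    (h2 : v ∈ B) : A = B := by
  by_contra hne
  exact Finset.disjoint_left.1 (hC.2 A hA B hB hne) h1 h2

theorem ind3 {a b c : V} (h1 : ¬ G.Adj a b) (h2 : ¬ G.Adj a c) (h3 : ¬ G.Adj b c) : Ind G {a, b, c} := by
  have h1' : ¬ G.Adj b a := fun h => h1 h.symm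
  have h2' : ¬ G.Adj c a := fun h => h2 h.symm
  have h3' : ¬ G.Adj c b := fun h => h3 h.symm
  intro u hu v hv
  simp only [Finset.mem_insert, Finset.mem_singleton] at hu hv
  rcases hu with rfl | rfl | rfl <;> rcases hv with rfl | rfl | rfl <;> simp_all

theorem ind2 {a b : V} (h1 : ¬ G.Adj a b) : Ind G {a, b} := by
  have h1' : ¬ G.Adj b a := fun h => h1 h.symm
  intro u hu v hv
  simp only [Finset.mem_insert, Finset.mem_singleton] at hu hv
  rcases hu with rfl | rfl <;> rcases hv with rfl | rfl <;> simp_all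

theorem hit (hM : Mx G r s C) {x y z : V} (hx : NT C x) (hy : NT C y) (hz : NT C z)
    (hxy : x ≠ y) (hxz : x ≠ z) (hyz : y ≠ z) (hn : ¬ G.Adj x y) : G.Adj z x ∨ G.Adj z y := by
  by_contra hc
  push Not at hc
  refine gain0 hM {z, x, y} ?_ (ind3 hc.1 hc.2 hn) ?_
  · rw [Finset.card_eq_three]; exact ⟨z, x, y, hxz.symm, hyz.symm, hxy, rfl⟩
  · intro A hA h3
    rw [Finset.disjoint_left]
    intro v hv
    simp only [Finset.mem_insert, Finset.mem_singleton] at hv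
    rcases hv with rfl | rfl | rfl
    · exact hz A hA h3
    · exact hx A hA h3
    · exact hy A hA h3

theorem gain6 (hM : Mx G r s C) {A : Finset V} (hA : A ∈ C) {p q v p' q' v' : V}
    (hnd : [p, q, v, p', q', v'].Nodup) (hin : ∀ x ∈ [p, q, v, p', q', v'], x ∈ A ∨ NT C x)
    (h1 : ¬ G.Adj p q) (h2 : ¬ G.Adj p v) (h3 : ¬ G.Adj q v)
    (h1' : ¬ G.Adj p' q') (h2' : ¬ G.Adj p' v') (h3' : ¬ G.Adj q' v') : False := by
  simp only [List.nodup_cons, List.mem_cons, List.not_mem_nil, or_false, not_or, List.nodup_nil, not_false_eq_true, and_true] at hnd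
  have hin2 : ∀ x ∈ [p, q, v, p', q', v'], ∀ B ∈ C, B.card = 3 → B ≠ A → x ∉ B := by
    intro x hx B hB hB3 hne hxB
    rcases hin x hx with h | h
    · exact hne (cls_uniq hM.1 hB hA hxB h)
    · exact h B hB hB3 hxB
  simp only [List.mem_cons, List.not_mem_nil, or_false, forall_eq_or_imp, forall_eq] at hin2
  refine gain1 hM hA {p, q, v} {p', q', v'} ?_ (ind3 h1 h2 h3) ?_ (ind3 h1' h2' h3') ?_ ?_
  · rw [Finset.card_eq_three]; exact ⟨p, q, v, by tauto, by tauto, by tauto, rfl⟩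
  · rw [Finset.card_eq_three]; exact ⟨p', q', v', by tauto, by tauto, by tauto, rfl⟩
  · rw [Finset.disjoint_left]
    intro x hx hx'
    simp only [Finset.mem_insert, Finset.mem_singleton] at hx hx'
    grind
  · intro B hB hB3 hne
    constructor <;>
    · rw [Finset.disjoint_left]
      intro x hx
      simp only [Finset.mem_insert, Finset.mem_singleton] at hx
      grind

theorem phi_fin {P Q R1 R2 R3 R4 : Prop} (h : ¬ P → ¬ Q → R1 ∧ R2 ∧ R3 ∧ R4) :
      (P ∨ Q) ∨ (((R1 ∧ R2) ∧ R3) ∧ R4) := by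
  tauto

theorem phiL (hM : Mx G r s C) {a b c x y u v : V} (hA : ({a, b, c} : Finset V) ∈ C)
    (hnd : [a, b, c, x, y, u, v].Nodup) (hx : NT C x) (hy : NT C y) (hu : NT C u) (hv : NT C v)
    (hxy : ¬ G.Adj x y) (huv : ¬ G.Adj u v) :
    phi (decide (G.Adj x a)) (decide (G.Adj x b)) (decide (G.Adj x c))
      (decide (G.Adj y a)) (decide (G.Adj y b)) (decide (G.Adj y c))
      (decide (G.Adj u a)) (decide (G.Adj u b)) (decide (G.Adj u c))
      (decide (G.Adj v a)) (decide (G.Adj v b)) (decide (G.Adj v c)) = true := by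
  have hI := (hM.1.1 _ hA).2
  simp only [List.nodup_cons, List.mem_cons, List.not_mem_nil, or_false, not_or, List.nodup_nil, not_false_eq_true, and_true] at hnd
  obtain ⟨⟨ab, ac, ax, ay, au, av⟩, ⟨bc, bx, by', bu, bv⟩, ⟨cx, cy, cu, cv⟩, ⟨xy, xu, xv⟩, ⟨yu, yv⟩, uv⟩ := hnd
  have key : ∀ a' b' c' : V, a' ∈ ({a, b, c} : Finset V) → b' ∈ ({a, b, c} : Finset V) →
      c' ∈ ({a, b, c} : Finset V) → a' ≠ b' → a' ≠ c' → b' ≠ c' → ¬ G.Adj x a' → ¬ G.Adj y a' →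
      (G.Adj u b' ∨ G.Adj u c') ∧ (G.Adj v b' ∨ G.Adj v c') ∧ (G.Adj u b' ∨ G.Adj v b') ∧
        (G.Adj u c' ∨ G.Adj v c') := by
    intro a' b' c' ha hb hc h1 h2 h3 hxa hya
    have hab := hI a' ha b' hb
    have hac := hI a' ha c' hc
    have hbc := hI b' hb c' hc
    have hd : ∀ p ∈ ({a, b, c} : Finset V), p ≠ x ∧ p ≠ y ∧ p ≠ u ∧ p ≠ v := by
      intro p hp
      simp only [Finset.mem_insert, Finset.mem_singleton] at hp
      rcases hp with rfl | rfl | rfl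
      · exact ⟨ax, ay, au, av⟩
      · exact ⟨bx, by', bu, bv⟩
      · exact ⟨cx, cy, cu, cv⟩
    have da := hd a' ha
    have db := hd b' hb
    have dc := hd c' hc
    have hyx : ¬ G.Adj y x := fun h => hxy h.symm
    have gg : ∀ p q w' : V, [x, y, a', p, q, w'].Nodup → (∀ z ∈ [p, q, w'], z ∈ ({a, b, c} : Finset V) ∨ NT C z) →
        ¬ G.Adj p q → ¬ G.Adj p w' → ¬ G.Adj q w' → False := by
      intro p q w' h1 h2 h3 h4 h5
      refine gain6 hM hA h1 ?_ hxy hxa hya h3 h4 h5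
      intro z hz
      simp only [List.mem_cons, List.not_mem_nil, or_false] at hz h2
      rcases hz with rfl | rfl | rfl | hz
      · exact Or.inr hx
      · exact Or.inr hy
      · exact Or.inl ha
      · exact h2 z hz
    refine ⟨?_, ?_, ?_, ?_⟩
    · by_contra hcon
      push Not at hcon
      refine gg u b' c' ?_ ?_ hcon.1 hcon.2 hbc
      · simp only [List.nodup_cons, List.mem_cons, List.not_mem_nil, or_false, not_or, List.nodup_nil, not_false_eq_true, and_true]
        clear hM hA hx hy hu hv hxy huv hI gg hcon hab hac hbc hxa hya hyx ha hb hc hd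
        grind
      · simp only [List.mem_cons, List.not_mem_nil, or_false, forall_eq_or_imp, forall_eq]
        exact ⟨Or.inr hu, Or.inl hb, Or.inl hc⟩
    · by_contra hcon
      push Not at hcon
      refine gg v b' c' ?_ ?_ hcon.1 hcon.2 hbc
      · simp only [List.nodup_cons, List.mem_cons, List.not_mem_nil, or_false, not_or, List.nodup_nil, not_false_eq_true, and_true]
        clear hM hA hx hy hu hv hxy huv hI gg hcon hab hac hbc hxa hya hyx ha hb hc hd
        grind
      · simp only [List.mem_cons, List.not_mem_nil, or_false, forall_eq_or_imp, forall_eq]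
        exact ⟨Or.inr hv, Or.inl hb, Or.inl hc⟩
    · by_contra hcon
      push Not at hcon
      refine gg u v b' ?_ ?_ huv hcon.1 hcon.2
      · simp only [List.nodup_cons, List.mem_cons, List.not_mem_nil, or_false, not_or, List.nodup_nil, not_false_eq_true, and_true]
        clear hM hA hx hy hu hv hxy huv hI gg hcon hab hac hbc hxa hya hyx ha hb hc hd
        grind
      · simp only [List.mem_cons, List.not_mem_nil, or_false, forall_eq_or_imp, forall_eq]
        exact ⟨Or.inr hu, Or.inr hv, Or.inl hb⟩
    · by_contra hcon
      push Not at hcon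
      refine gg u v c' ?_ ?_ huv hcon.1 hcon.2
      · simp only [List.nodup_cons, List.mem_cons, List.not_mem_nil, or_false, not_or, List.nodup_nil, not_false_eq_true, and_true]
        clear hM hA hx hy hu hv hxy huv hI gg hcon hab hac hbc hxa hya hyx ha hb hc hd
        grind
      · simp only [List.mem_cons, List.not_mem_nil, or_false, forall_eq_or_imp, forall_eq]
        exact ⟨Or.inr hu, Or.inr hv, Or.inl hc⟩
  have k1 := key a b c (by simp) (by simp) (by simp) ab ac bc
  have k2 := key b a c (by simp) (by simp) (by simp) (Ne.symm ab) bc ac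
  have k3 := key c a b (by simp) (by simp) (by simp) (Ne.symm ac) (Ne.symm bc) ab
  unfold phi
  simp only [Bool.and_eq_true, Bool.or_eq_true, decide_eq_true_eq]
  exact ⟨⟨phi_fin k1, phi_fin k2⟩, phi_fin k3⟩

theorem US_card (hM : Mx G r s C) {t : ℕ} (hn : Fintype.card V = 3 * r + 2 * s + t) : (US C).card = t := by
  have := card_V hM.1
  rw [hM.2.1, hM.2.2.1] at this
  omega

theorem ee_US (hM : Mx G r s C) {u : V} (hu : u ∈ US C) : ee G u (US C) + 1 = (US C).card := by
  have h : ∀ x ∈ (US C).erase u, wt G u x = 1 := by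
    intro x hx
    rw [Finset.mem_erase] at hx
    exact wt_one.2 (US_clique hM hu hx.2 hx.1.symm)
  unfold ee
  rw [← Finset.add_sum_erase _ _ hu, Finset.sum_congr rfl h, wt_zero.2 G.irrefl]
  simp only [Finset.sum_const, smul_eq_mul, mul_one, zero_add]
  exact Finset.card_erase_add_one hu

theorem ee_pair_ge (hM : Mx G r s C) {B : Finset V} (hB : B ∈ C) (h2 : B.card = 2) {z : V} (hz : NT C z)
    (hzB : z ∉ B) : 1 ≤ ee G z B := by
  obtain ⟨x, y, hne, rfl⟩ := Finset.card_eq_two.1 h2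
  have hI := (hM.1.1 _ hB).2 x (by simp) y (by simp)
  simp only [Finset.mem_insert, Finset.mem_singleton, not_or] at hzB
  rw [ee_pos]
  rcases hit hM (NT_pair hM.1 hB h2 (by simp : x ∈ _)) (NT_pair hM.1 hB h2 (by simp : y ∈ _)) hz hne (Ne.symm hzB.1) (Ne.symm hzB.2) hI with h | h
  · exact ⟨x, by simp, h⟩
  · exact ⟨y, by simp, h⟩

theorem one_of (hM : Mx G r s C) {t : ℕ} (hn : Fintype.card V = 3 * r + 2 * s + t)
    (hdeg : ∀ v, G.degree v + 1 ≤ r + s + t) {u : V} (hu : u ∈ US C) (h : ∀ A ∈ C, 1 ≤ ee G u A) :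
    (∀ A ∈ C, ee G u A = 1) ∧ G.degree u + 1 = r + s + t := by
  have h1 := deg_eq hM.1 u
  have h2 := ee_US hM hu
  rw [US_card hM hn] at h2
  have h3 := hdeg u
  have h4 := card_C hM.1
  rw [hM.2.1, hM.2.2.1] at h4
  have h5 : ∑ A ∈ C, 1 ≤ ∑ A ∈ C, ee G u A := Finset.sum_le_sum h
  have h6 : ∑ A ∈ C, 1 = C.card := by simp
  have h7 : ∑ A ∈ C, 1 = ∑ A ∈ C, ee G u A := by omega
  refine ⟨fun A hA => ?_, by omega⟩
  exact ((Finset.sum_eq_sum_iff_of_le h).1 h7 A hA).symm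

theorem sum23 (hC : Conf G C) (f : Finset V → ℕ) : ∑ A ∈ C, f A =
    ∑ A ∈ C.filter (fun A => A.card = 3), f A + ∑ A ∈ C.filter (fun A => A.card = 2), f A := by
  rw [Finset.sum_filter, Finset.sum_filter, ← Finset.sum_add_distrib]
  refine Finset.sum_congr rfl fun A hA => ?_
  rcases (hC.1 A hA).1 with h | h <;> simp [h]

theorem t2_one (hM : Mx G r s C) {t : ℕ} (hn : Fintype.card V = 3 * r + 2 * s + t)
    (hdeg : ∀ v, G.degree v + 1 ≤ r + s + t) (ht : 2 ≤ t) :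
    ∀ u ∈ US C, ∀ A ∈ C, 1 ≤ ee G u A := by
  have hcard := US_card hM hn
  -- zero case
  have hz : ∀ A ∈ C, ∀ u ∈ US C, ee G u A = 0 → ∀ v ∈ US C, v ≠ u → ee G v A = A.card := by
    intro A hA u hu h0 v hv hne
    have : ∀ a ∈ A, wt G v a = 1 := by
      intro a ha
      obtain ⟨C', hM', h1, h2, h3⟩ := ex1 hM hA ha hu (fun x hx _ => ee_zero.1 h0 x hx)
      refine wt_one.2 (US_clique hM' ?_ ?_ ?_)
      · rw [h2]; simp [hne, hv]
      · rw [h2]; simp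
      · rintro rfl
        exact mem_US.1 hv A hA ha
    unfold ee
    rw [Finset.sum_congr rfl this]
    simp
  have hge : ∀ A ∈ C.filter (fun A => A.card = 3), t ≤ ∑ u ∈ US C, ee G u A ∧
      (∑ u ∈ US C, ee G u A ≤ t → ∀ u ∈ US C, 1 ≤ ee G u A) := by
    intro A hA
    rw [Finset.mem_filter] at hA
    by_cases hall : ∀ u ∈ US C, 1 ≤ ee G u A
    · have := Finset.sum_le_sum hall
      simp only [Finset.sum_const, smul_eq_mul, mul_one] at this
      exact ⟨by omega, fun _ => hall⟩
    · push Not at hall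
      obtain ⟨u, hu, h0⟩ := hall
      have h0' : ee G u A = 0 := by omega
      have h1 : ∀ v ∈ (US C).erase u, ee G v A = 3 := by
        intro v hv
        rw [Finset.mem_erase] at hv
        rw [hz A hA.1 u hu h0' v hv.2 hv.1, hA.2]
      rw [← Finset.add_sum_erase _ _ hu, Finset.sum_congr rfl h1]
      simp only [Finset.sum_const, smul_eq_mul]
      have := Finset.card_erase_add_one hu
      exact ⟨by omega, fun h => by omega⟩
  have hub : ∀ u ∈ US C, ∑ A ∈ C.filter (fun A => A.card = 3), ee G u A ≤ r := by
    intro u hu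
    have h1 := deg_eq hM.1 u
    rw [sum23 hM.1] at h1
    have h2 := ee_US hM hu
    have h3 := hdeg u
    have h4 : ∑ A ∈ C.filter (fun A => A.card = 2), 1 ≤ ∑ A ∈ C.filter (fun A => A.card = 2), ee G u A := by
      refine Finset.sum_le_sum fun B hB => ?_
      rw [Finset.mem_filter] at hB
      exact ee_pair_ge hM hB.1 hB.2 (NT_US hu) (mem_US.1 hu B hB.1)
    simp only [Finset.sum_const, smul_eq_mul, mul_one] at h4
    have h5 := hM.2.2.1
    unfold c2 at h5
    omega
  have h1 := Finset.sum_le_sum hub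
  rw [Finset.sum_comm] at h1
  simp only [Finset.sum_const, smul_eq_mul] at h1
  have h2 := Finset.sum_le_sum (fun A hA => (hge A hA).1)
  simp only [Finset.sum_const, smul_eq_mul] at h2
  have h3 := hM.2.1
  unfold c3 at h3
  rw [h3] at h2
  have h4 : ∑ A ∈ C.filter (fun A => A.card = 3), t = ∑ A ∈ C.filter (fun A => A.card = 3), ∑ u ∈ US C, ee G u A := by
    simp only [Finset.sum_const, smul_eq_mul]
    rw [h3]
    rw [hcard] at h1
    exact le_antisymm h2 (h1.trans (mul_comm _ _).le)
  have h5 := (Finset.sum_eq_sum_iff_of_le (fun A hA => (hge A hA).1)).1 h4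
  intro u hu A hA
  rcases (hM.1.1 A hA).1 with hA2 | hA3
  · exact ee_pair_ge hM hA hA2 (NT_US hu) (mem_US.1 hu A hA)
  · have hm : A ∈ C.filter (fun A => A.card = 3) := Finset.mem_filter.2 ⟨hA, hA3⟩
    exact (hge A hm).2 (h5 A hm).ge u hu

theorem case_t2 (hM : Mx G r s C) {t : ℕ} (hn : Fintype.card V = 3 * r + 2 * s + t)
    (hdeg : ∀ v, G.degree v + 1 ≤ r + s + t) (ht : 2 ≤ t)
    (hnk : ∀ u, G.degree u + 1 = r + s + t → ∃ p q, G.Adj u p ∧ G.Adj u q ∧ p ≠ q ∧ ¬ G.Adj p q) :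
    False := by
  have one : ∀ C, Mx G r s C → ∀ u ∈ US C, ∀ A ∈ C, ee G u A = 1 := fun C hM u hu =>
    (one_of hM hn hdeg hu (t2_one hM hn hdeg ht u hu)).1
  have sw : ∀ C, Mx G r s C → ∀ u ∈ US C, ∀ A ∈ C, ∀ q ∈ A, G.Adj u q →
      ∃ C', Mx G r s C' ∧ insert u (A.erase q) ∈ C' ∧ US C' = insert q ((US C).erase u) ∧
      ∀ Q ∈ C, Q ≠ A → Q ∈ C' := by
    intro C hM u hu A hA q hq huq
    refine ex1 hM hA hq hu ?_
    intro x hx hne hux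
    exact hne (ee_uniq (one C hM u hu A hA).le hx hq hux huq)
  have k1 : ∀ C, Mx G r s C → ∀ u ∈ US C, ∀ v ∈ US C, v ≠ u → ∀ A ∈ C, ∀ q ∈ A, G.Adj u q → G.Adj v q := by
    intro C hM u hu v hv hne A hA q hq huq
    obtain ⟨C', hM', h1, h2, h3⟩ := sw C hM u hu A hA q hq huq
    refine US_clique hM' ?_ ?_ ?_
    · rw [h2]; simp [hne, hv]
    · rw [h2]; simp
    · rintro rfl
      exact mem_US.1 hv A hA hq
  have hc := US_card hM hn
  obtain ⟨u, hu, v, hv, hne⟩ := Finset.one_lt_card.1 (show 1 < (US C).card by omega)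
  obtain ⟨p, q, hp, hq, hpq, hna⟩ := hnk u (one_of hM hn hdeg hu (t2_one hM hn hdeg ht u hu)).2
  have cl : ∀ p, p ∈ US C ∨ ∃ A ∈ C, p ∈ A := by
    intro p
    by_cases h : p ∈ US C
    · exact Or.inl h
    · rw [mem_US] at h; push Not at h; exact Or.inr h
  rcases cl p with hpU | ⟨A, hA, hpA⟩ <;> rcases cl q with hqU | ⟨B, hB, hqB⟩
  · exact hna (US_clique hM hpU hqU hpq)
  · exact hna (k1 C hM u hu p hpU hp.ne' B hB q hqB hq)
  · exact hna (k1 C hM u hu q hqU hq.ne' A hA p hpA hp).symm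
  · have hAB : A ≠ B := by
      rintro rfl
      exact hpq (ee_uniq (one C hM u hu A hA).le hpA hqB hp hq)
    obtain ⟨C', hM', h1, h2, h3⟩ := sw C hM u hu A hA p hpA hp
    have hvq := k1 C hM u hu v hv hne.symm B hB q hqB hq
    refine hna (k1 C' hM' v (by rw [h2]; simp [hv, hne.symm]) p (by rw [h2]; simp) ?_ B (h3 B hB hAB.symm) q hqB hvq)
    rintro rfl
    exact mem_US.1 hv A hA hpA

theorem tri_facts (hM : Mx G r s C) {A : Finset V} (hA : A ∈ C) (hA3 : A.card = 3) {x y u v : V}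
    (hnd : [x, y, u, v].Nodup) (hx : NT C x) (hy : NT C y) (hu : NT C u) (hv : NT C v)
    (hxy : ¬ G.Adj x y) (huv : ¬ G.Adj u v) :
    (4 ≤ ee G x A + ee G y A + (ee G u A + ee G v A)) ∧
    (¬ G.Adj x v → ¬ G.Adj u y → ee G x A + ee G y A + (ee G u A + ee G v A) = 4 →
      ee G x A + ee G u A = 2) ∧
    (ee G x A + ee G y A = 2 → ee G u A + ee G v A = 2 → ee G x A = 1 ∧
      (∀ q ∈ A, wt G q x + wt G q y ≤ 1 ∧ wt G q x + wt G q y = wt G q u + wt G q v) ∧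
      ∃ q ∈ A, wt G q x + wt G q y = 0) := by
  obtain ⟨a, b, c, hab, hac, hbc, rfl⟩ := Finset.card_eq_three.1 hA3
  have ne : ∀ z, NT C z → z ≠ a ∧ z ≠ b ∧ z ≠ c := by
    intro z hz
    have := hz _ hA hA3
    simpa [not_or] using this
  have nx := ne x hx
  have ny := ne y hy
  have nu := ne u hu
  have nv := ne v hv
  have nd1 : [a, b, c, x, y, u, v].Nodup := by
    simp only [List.nodup_cons, List.mem_cons, List.not_mem_nil, or_false, not_or, List.nodup_nil, not_false_eq_true, and_true] at hnd ⊢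
    clear ne hM hA hA3
    grind
  have nd2 : [a, b, c, u, v, x, y].Nodup := by
    simp only [List.nodup_cons, List.mem_cons, List.not_mem_nil, or_false, not_or, List.nodup_nil, not_false_eq_true, and_true] at hnd ⊢
    clear ne hM hA hA3
    grind
  have nd3 : [a, b, c, x, v, u, y].Nodup := by
    simp only [List.nodup_cons, List.mem_cons, List.not_mem_nil, or_false, not_or, List.nodup_nil, not_false_eq_true, and_true] at hnd ⊢
    clear ne hM hA hA3
    grind
  have nd4 : [a, b, c, u, y, x, v].Nodup := by
    simp only [List.nodup_cons, List.mem_cons, List.not_mem_nil, or_false, not_or, List.nodup_nil, not_false_eq_true, and_true] at hnd ⊢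
    clear ne hM hA hA3
    grind
  have p1 := phiL hM hA nd1 hx hy hu hv hxy huv
  have p2 := phiL hM hA nd2 hu hv hx hy huv hxy
  have hs : ∀ z, ee G z {a, b, c} = wt G z a + wt G z b + wt G z c := by
    intro z
    unfold ee
    rw [Finset.sum_insert (by simp [hab, hac]), Finset.sum_pair hbc]
    omega
  rw [hs, hs, hs, hs]
  refine ⟨?_, ?_, ?_⟩
  · exact phi_sum _ _ _ _ _ _ _ _ _ _ _ _ p1 p2
  · intro hxv huy h4
    have p3 := phiL hM hA nd3 hx hv hu hy hxv huy
    have p4 := phiL hM hA nd4 hu hy hx hv huy hxv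
    exact phi_re _ _ _ _ _ _ _ _ _ _ _ _ p1 p2 p3 p4 h4
  · intro h1 h2
    obtain ⟨k1, ⟨k2, k3, k4⟩, ⟨k5, k6, k7⟩, k8⟩ := phi_two _ _ _ _ _ _ _ _ _ _ _ _ p1 p2 h1 h2
    refine ⟨k1, ?_, ?_⟩
    · intro q hq
      rw [wt_comm q, wt_comm q y, wt_comm q u, wt_comm q v]
      simp only [Finset.mem_insert, Finset.mem_singleton] at hq
      rcases hq with rfl | rfl | rfl
      · exact ⟨k2, k5⟩
      · exact ⟨k3, k6⟩
      · exact ⟨k4, k7⟩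
    · rcases k8 with h | h | h
      · exact ⟨a, by simp, by rw [wt_comm a, wt_comm a y]; exact h⟩
      · exact ⟨b, by simp, by rw [wt_comm b, wt_comm b y]; exact h⟩
      · exact ⟨c, by simp, by rw [wt_comm c, wt_comm c y]; exact h⟩

theorem nd4 (hC : Conf G C) {x y u v : V} (hB : {x, y} ∈ C) (hB' : {u, v} ∈ C) (hxy : x ≠ y) (huv : u ≠ v)
    (hne : ({x, y} : Finset V) ≠ {u, v}) : [x, y, u, v].Nodup := by
  have hd := hC.2 _ hB _ hB' hne
  simp only [Finset.disjoint_left, Finset.mem_insert, Finset.mem_singleton, forall_eq_or_imp, forall_eq, not_or] at hd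
  simp only [List.nodup_cons, List.mem_cons, List.not_mem_nil, or_false, not_or, List.nodup_nil, not_false_eq_true, and_true]
  exact ⟨⟨hxy, hd.1.1, hd.1.2⟩, ⟨hd.2.1, hd.2.2⟩, huv⟩

def FF (G : SimpleGraph V) [DecidableRel G.Adj] (x y u v : V) (A : Finset V) : ℕ :=
  ee G x A + ee G y A + (ee G u A + ee G v A) + ((if A = {x, y} then 2 else 0) + (if A = {u, v} then 2 else 0))

theorem ee_self (hC : Conf G C) {A : Finset V} (hA : A ∈ C) {x : V} (hx : x ∈ A) : ee G x A = 0 :=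
  ee_zero.2 fun a ha => (hC.1 A hA).2 x hx a ha

theorem FF_ge (hM : Mx G r s C) {x y u v : V} (hB : {x, y} ∈ C) (hB' : {u, v} ∈ C) (hxy : x ≠ y) (huv : u ≠ v)
    (hne : ({x, y} : Finset V) ≠ {u, v}) {A : Finset V} (hA : A ∈ C) : 4 ≤ FF G x y u v A := by
  have hnd := nd4 hM.1 hB hB' hxy huv hne
  have c1 : ({x, y} : Finset V).card = 2 := Finset.card_pair hxy
  have c2 : ({u, v} : Finset V).card = 2 := Finset.card_pair huv
  have hx := NT_pair hM.1 hB c1 (by simp : x ∈ _)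
  have hy := NT_pair hM.1 hB c1 (by simp : y ∈ _)
  have hu := NT_pair hM.1 hB' c2 (by simp : u ∈ _)
  have hv := NT_pair hM.1 hB' c2 (by simp : v ∈ _)
  rcases (hM.1.1 A hA).1 with hA2 | hA3
  · have g : ∀ z B, B ∈ C → z ∈ B → A ≠ B → NT C z → 1 ≤ ee G z A := by
      intro z B hB hz hne hzn
      exact ee_pair_ge hM hA hA2 hzn (fun h => hne (cls_uniq hM.1 hA hB h hz))
    unfold FF
    by_cases h1 : A = {x, y}
    · have := g u _ hB' (by simp) (by rw [h1]; exact hne) hu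
      have := g v _ hB' (by simp) (by rw [h1]; exact hne) hv
      rw [if_pos h1]; omega
    · by_cases h2 : A = {u, v}
      · have := g x _ hB (by simp) h1 hx
        have := g y _ hB (by simp) h1 hy
        rw [if_pos h2]; omega
      · have := g u _ hB' (by simp) h2 hu
        have := g v _ hB' (by simp) h2 hv
        have := g x _ hB (by simp) h1 hx
        have := g y _ hB (by simp) h1 hy
        omega
  · have := (tri_facts hM hA hA3 hnd hx hy hu hv ((hM.1.1 _ hB).2 x (by simp) y (by simp)) ((hM.1.1 _ hB').2 u (by simp) v (by simp))).1
    unfold FF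
    omega

theorem FF_sum (hC : Conf G C) {x y u v : V} (hB : {x, y} ∈ C) (hB' : {u, v} ∈ C) :
    ∑ A ∈ C, FF G x y u v A + (ee G x (US C) + ee G y (US C) + (ee G u (US C) + ee G v (US C))) =
      G.degree x + G.degree y + (G.degree u + G.degree v) + 4 := by
  unfold FF
  rw [Finset.sum_add_distrib, Finset.sum_add_distrib, Finset.sum_add_distrib, Finset.sum_add_distrib, Finset.sum_add_distrib,
    Finset.sum_ite_eq', Finset.sum_ite_eq', if_pos hB, if_pos hB', deg_eq hC x, deg_eq hC y, deg_eq hC u, deg_eq hC v]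
  omega

theorem more_pairs (hM : Mx G r s C) (D : Finset (Finset V)) (hD : D.card < s) : ∃ B ∈ C, B.card = 2 ∧ B ∉ D := by
  have h := hM.2.2.1
  unfold c2 at h
  obtain ⟨B, h1, h2⟩ := Finset.exists_mem_notMem_of_card_lt_card (s := D) (t := C.filter (fun A => A.card = 2)) (by omega)
  rw [Finset.mem_filter] at h1
  exact ⟨B, h1.1, h1.2, h2⟩

section t0
variable (hn : Fintype.card V = 3 * r + 2 * s) (hdeg : ∀ v, G.degree v + 1 ≤ r + s)
include hn hdeg

theorem t0_tight (hM : Mx G r s C) {x y u v : V} (hB : {x, y} ∈ C) (hB' : {u, v} ∈ C) (hxy : x ≠ y) (huv : u ≠ v)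
    (hne : ({x, y} : Finset V) ≠ {u, v}) {A : Finset V} (hA : A ∈ C) : FF G x y u v A = 4 := by
  have h1 := FF_sum hM.1 hB hB'
  have hx := hdeg x
  have hy := hdeg y
  have hu := hdeg u
  have hv := hdeg v
  have h4 := card_C hM.1
  rw [hM.2.1, hM.2.2.1] at h4
  have hge : ∀ A ∈ C, 4 ≤ FF G x y u v A := fun A hA => FF_ge hM hB hB' hxy huv hne hA
  have h5 := Finset.sum_le_sum hge
  have h6 : ∑ A ∈ C, 4 = C.card * 4 := by simp
  have h7 : ∑ A ∈ C, 4 = ∑ A ∈ C, FF G x y u v A := by omega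
  exact ((Finset.sum_eq_sum_iff_of_le hge).1 h7 A hA).symm

theorem t0_alpha (hM : Mx G r s C) {B B' : Finset V} (hB : B ∈ C) (hB' : B' ∈ C) (h2 : B.card = 2)
    (h2' : B'.card = 2) (hne : B ≠ B') {x : V} (hx : x ∈ B) : ee G x B' = 1 := by
  have g : ∀ z ∈ B, 1 ≤ ee G z B' := fun z hz =>
    ee_pair_ge hM hB' h2' (NT_pair hM.1 hB h2 hz) (fun h => hne (cls_uniq hM.1 hB hB' hz h))
  obtain ⟨a, b, hab, rfl⟩ := Finset.card_eq_two.1 h2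
  obtain ⟨u, v, huv, rfl⟩ := Finset.card_eq_two.1 h2'
  have h := t0_tight hn hdeg hM hB hB' hab huv hne hB'
  unfold FF at h
  rw [if_neg hne.symm, if_pos rfl] at h
  have ga := g a (by simp)
  have gb := g b (by simp)
  simp only [Finset.mem_insert, Finset.mem_singleton] at hx
  rcases hx with rfl | rfl <;> omega

theorem t0_two (hs : 3 ≤ s) (hM : Mx G r s C) {A : Finset V} (hA : A ∈ C) (hA3 : A.card = 3) {x y : V}
    (hB : {x, y} ∈ C) (hxy : x ≠ y) : ee G x A + ee G y A = 2 := by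
  have key : ∀ B ∈ C, B.card = 2 → B ≠ {x, y} → ∃ u v, u ≠ v ∧ B = {u, v} := by
    intro B hB h2 _
    obtain ⟨u, v, h, h'⟩ := Finset.card_eq_two.1 h2
    exact ⟨u, v, h, h'⟩
  have c1 : ({x, y} : Finset V).card = 2 := Finset.card_pair hxy
  obtain ⟨B1, hB1, h12, n1⟩ := more_pairs hM {{x, y}} (by simp; omega)
  obtain ⟨B2, hB2, h22, n2⟩ := more_pairs hM {{x, y}, B1} (lt_of_le_of_lt Finset.card_le_two (by omega))
  obtain ⟨u, v, huv, rfl⟩ := Finset.card_eq_two.1 h12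
  obtain ⟨p, q, hpq, rfl⟩ := Finset.card_eq_two.1 h22
  simp only [Finset.mem_insert, Finset.mem_singleton, not_or] at n1 n2
  have nn : ∀ B : Finset V, B.card = 2 → A ≠ B := by rintro B h rfl; omega
  have k1 := t0_tight hn hdeg hM hB hB1 hxy huv (Ne.symm n1) hA
  have k2 := t0_tight hn hdeg hM hB hB2 hxy hpq (Ne.symm n2.1) hA
  have k3 := t0_tight hn hdeg hM hB1 hB2 huv hpq (Ne.symm n2.2) hA
  unfold FF at k1 k2 k3
  rw [if_neg (nn _ c1), if_neg (nn _ h12)] at k1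
  rw [if_neg (nn _ c1), if_neg (nn _ h22)] at k2
  rw [if_neg (nn _ h12), if_neg (nn _ h22)] at k3
  omega

theorem t0_beta (hs : 3 ≤ s) (hM : Mx G r s C) {A B B' : Finset V} (hA : A ∈ C) (hA3 : A.card = 3)
    (hB : B ∈ C) (hB' : B' ∈ C) (h2 : B.card = 2) (h2' : B'.card = 2) (hne : B ≠ B') :
    (∀ x ∈ B, ee G x A = 1) ∧ (∀ q ∈ A, ee G q B ≤ 1 ∧ ee G q B = ee G q B') ∧
      ∃ q ∈ A, ee G q B = 0 := by
  obtain ⟨x, y, hxy, rfl⟩ := Finset.card_eq_two.1 h2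
  obtain ⟨u, v, huv, rfl⟩ := Finset.card_eq_two.1 h2'
  have hnd := nd4 hM.1 hB hB' hxy huv hne
  have hx := NT_pair hM.1 hB h2 (by simp : x ∈ _)
  have hy := NT_pair hM.1 hB h2 (by simp : y ∈ _)
  have hu := NT_pair hM.1 hB' h2' (by simp : u ∈ _)
  have hv := NT_pair hM.1 hB' h2' (by simp : v ∈ _)
  have e1 := t0_two hn hdeg hs hM hA hA3 hB hxy
  have e2 := t0_two hn hdeg hs hM hA hA3 hB' huv
  obtain ⟨k1, k2, k3⟩ := (tri_facts hM hA hA3 hnd hx hy hu hv ((hM.1.1 _ hB).2 x (by simp) y (by simp)) ((hM.1.1 _ hB').2 u (by simp) v (by simp))).2.2 e1 e2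
  simp only [ee_pair hxy, ee_pair huv]
  refine ⟨?_, k2, k3⟩
  intro z hz
  simp only [Finset.mem_insert, Finset.mem_singleton] at hz
  rcases hz with rfl | rfl <;> omega

theorem t0_mixed (hs : 3 ≤ s) (hM : Mx G r s C) {A B0 B : Finset V} (hA : A ∈ C) (hA3 : A.card = 3)
    (hB0 : B0 ∈ C) (hB : B ∈ C) (h20 : B0.card = 2) (h2 : B.card = 2) (hne : B0 ≠ B) {x p q : V}
    (hx : x ∈ B0) (hp : p ∈ B) (hq : q ∈ A) (hxp : G.Adj x p) (hxq : G.Adj x q) : G.Adj p q := by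
  obtain ⟨y, hxy, rfl⟩ : ∃ y, x ≠ y ∧ B0 = {x, y} := by
    obtain ⟨a, b, hab, rfl⟩ := Finset.card_eq_two.1 h20
    simp only [Finset.mem_insert, Finset.mem_singleton] at hx
    rcases hx with rfl | rfl
    · exact ⟨b, hab, rfl⟩
    · exact ⟨a, hab.symm, Finset.pair_comm _ _⟩
  obtain ⟨p', hpp, rfl⟩ : ∃ y, p ≠ y ∧ B = {p, y} := by
    obtain ⟨a, b, hab, rfl⟩ := Finset.card_eq_two.1 h2
    simp only [Finset.mem_insert, Finset.mem_singleton] at hp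
    rcases hp with rfl | rfl
    · exact ⟨b, hab, rfl⟩
    · exact ⟨a, hab.symm, Finset.pair_comm _ _⟩
  have a1 := t0_alpha hn hdeg hM hB0 hB h20 h2 hne hx
  have a2 := t0_alpha hn hdeg hM hB hB0 h2 h20 hne.symm hp
  have hxp' : ¬ G.Adj x p' := fun h => hpp (ee_uniq a1.le hp (by simp) hxp h)
  have hpy : ¬ G.Adj p y := fun h => hxy (ee_uniq a2.le hx (by simp) hxp.symm h)
  obtain ⟨-, b2, -⟩ := t0_beta hn hdeg hs hM hA hA3 hB0 hB h20 h2 hne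
  have hqy : ¬ G.Adj q y := fun h => hxy (ee_uniq (b2 q hq).1 hx (by simp) hxq.symm h)
  have hnd := nd4 hM.1 hB0 hB hxy hpp hne
  simp only [List.nodup_cons, List.mem_cons, List.not_mem_nil, or_false, not_or, List.nodup_nil, not_false_eq_true, and_true] at hnd
  obtain ⟨⟨_, xp, xp'⟩, ⟨yp, yp'⟩, _⟩ := hnd
  have c1 : ({x, p'} : Finset V).card = 2 := Finset.card_pair xp'
  have c2 : ({p, y} : Finset V).card = 2 := Finset.card_pair (Ne.symm yp)
  have hM' := ex2 hM (A' := {x, p'}) (B' := {p, y}) hB0 hB hne (by rw [c1, h20]) (by rw [c2, h2]) (ind2 hxp') (ind2 hpy)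
    (by
      simp only [Finset.disjoint_left, Finset.mem_insert, Finset.mem_singleton, forall_eq_or_imp, forall_eq, not_or]
      exact ⟨⟨xp, hxy⟩, Ne.symm hpp, Ne.symm yp'⟩)
    (by
      intro Q hQ n1 n2
      have d1 := hM.1.2 _ hQ _ hB0 n1
      have d2 := hM.1.2 _ hQ _ hB n2
      simp only [Finset.disjoint_right, Finset.mem_insert, Finset.mem_singleton, forall_eq_or_imp, forall_eq] at d1 d2
      simp only [Finset.disjoint_left, Finset.mem_insert, Finset.mem_singleton, forall_eq_or_imp, forall_eq]
      exact ⟨⟨d1.1, d2.2⟩, d2.1, d1.2⟩)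
  have hA' : A ∈ insert {x, p'} (insert {p, y} ((C.erase {x, y}).erase {p, p'})) := by
    have n1 : A ≠ {x, y} := by rintro rfl; omega
    have n2 : A ≠ {p, p'} := by rintro rfl; omega
    simp [hA, n1, n2]
  obtain ⟨-, b2', -⟩ := t0_beta hn hdeg hs hM' hA' hA3 (B := {x, p'}) (B' := {p, y}) (by simp) (by simp) c1 c2
    (by
      intro h
      have : x ∈ ({p, y} : Finset V) := by rw [← h]; simp
      simp only [Finset.mem_insert, Finset.mem_singleton] at this
      tauto)
  have e1 := (b2' q hq).2
  have e2 : 1 ≤ ee G q {x, p'} := ee_pos.2 ⟨x, by simp, hxq.symm⟩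
  obtain ⟨z, hz, hqz⟩ := ee_pos.1 (show 1 ≤ ee G q {p, y} by omega)
  simp only [Finset.mem_insert, Finset.mem_singleton] at hz
  rcases hz with rfl | rfl
  · exact hqz.symm
  · exact absurd hqz hqy

theorem case_t0 (hs : 3 ≤ s) (hM : Mx G r s C)
    (hnk : ∀ u, G.degree u + 1 = r + s → ∃ p q, G.Adj u p ∧ G.Adj u q ∧ p ≠ q ∧ ¬ G.Adj p q) :
    False := by
  have hU : US C = ∅ := by
    rw [← Finset.card_eq_zero]
    exact US_card hM (t := 0) hn
  obtain ⟨B0, hB0, h20, -⟩ := more_pairs hM ∅ (by simp; omega)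
  obtain ⟨B1, hB1, h21, n1⟩ := more_pairs hM {B0} (by simp; omega)
  rw [Finset.mem_singleton] at n1
  obtain ⟨x, y, hxy, rfl⟩ := Finset.card_eq_two.1 h20
  have one : ∀ A ∈ C, A ≠ {x, y} → ee G x A = 1 := by
    intro A hA hne
    rcases (hM.1.1 A hA).1 with h2 | h3
    · exact t0_alpha hn hdeg hM hB0 hA h20 h2 hne.symm (by simp)
    · exact (t0_beta hn hdeg hs hM hA h3 hB0 hB1 h20 h21 (Ne.symm n1)).1 x (by simp)
  have hd : G.degree x + 1 = r + s := by
    have h1 := deg_eq hM.1 x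
    rw [hU, ← Finset.add_sum_erase _ _ hB0, ee_self hM.1 hB0 (by simp)] at h1
    rw [Finset.sum_congr rfl (fun A hA => one A (Finset.mem_of_mem_erase hA) (Finset.ne_of_mem_erase hA))] at h1
    simp only [Finset.sum_const, smul_eq_mul, mul_one] at h1
    have h2 := Finset.card_erase_add_one hB0
    have h4 := card_C hM.1
    rw [hM.2.1, hM.2.2.1] at h4
    have : ee G x ∅ = 0 := by simp [ee]
    omega
  obtain ⟨p, q, hp, hq, hpq, hna⟩ := hnk x hd
  have cl : ∀ p, G.Adj x p → ∃ A ∈ C, p ∈ A ∧ A ≠ {x, y} := by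
    intro p hp
    have h : p ∉ US C := by rw [hU]; simp
    rw [mem_US] at h; push Not at h
    obtain ⟨A, hA, hpA⟩ := h
    refine ⟨A, hA, hpA, ?_⟩
    rintro rfl
    exact (hM.1.1 _ hA).2 x (by simp) p hpA hp
  obtain ⟨A, hA, hpA, hA0⟩ := cl p hp
  obtain ⟨B, hB, hqB, hB0'⟩ := cl q hq
  have hAB : A ≠ B := by
    rintro rfl
    exact hpq (ee_uniq (one A hA hA0).le hpA hqB hp hq)
  rcases (hM.1.1 A hA).1 with hA2 | hA3 <;> rcases (hM.1.1 B hB).1 with hB2 | hB3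
  · have g : ∀ z Z, Z ∈ C → Z.card = 2 → z ∈ Z → Z ≠ {x, y} → G.Adj x z → ¬ G.Adj y z := by
      intro z Z hZ hZ2 hz hne hxz hyz
      have := t0_alpha hn hdeg hM hZ hB0 hZ2 h20 hne hz
      exact hxy (ee_uniq this.le (by simp) (by simp) hxz.symm hyz.symm)
    have hy := NT_pair hM.1 hB0 h20 (by simp : y ∈ _)
    have ny : ∀ z Z, Z ∈ C → z ∈ Z → Z ≠ {x, y} → y ≠ z := by
      rintro z Z hZ hz hne rfl
      exact hne (cls_uniq hM.1 hZ hB0 hz (by simp))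
    rcases hit hM (NT_pair hM.1 hA hA2 hpA) (NT_pair hM.1 hB hB2 hqB) hy hpq (ny p A hA hpA hA0).symm (ny q B hB hqB hB0').symm hna with h | h
    · exact g p A hA hA2 hpA hA0 hp h
    · exact g q B hB hB2 hqB hB0' hq h
  · exact hna (t0_mixed hn hdeg hs hM hB hB3 hB0 hA h20 hA2 hA0.symm (by simp) hpA hqB hp hq)
  · exact hna (t0_mixed hn hdeg hs hM hA hA3 hB0 hB h20 hB2 hB0'.symm (by simp) hqB hpA hq hp).symm
  · obtain ⟨-, b2, -⟩ := t0_beta hn hdeg hs hM hA hA3 hB0 hB1 h20 h21 (Ne.symm n1)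
    obtain ⟨-, -, a, ha, ha0⟩ := t0_beta hn hdeg hs hM hA hA3 hB1 hB0 h21 h20 n1
    have hp1 : 1 ≤ ee G p B1 := by
      rw [← (b2 p hpA).2]
      exact ee_pos.2 ⟨x, by simp, hp.symm⟩
    have hpa : p ≠ a := by rintro rfl; omega
    have nA1 : A ≠ B1 := by rintro rfl; omega
    have haB1 : a ∉ B1 := fun h => nA1 (cls_uniq hM.1 hA hB1 ha h)
    have hdj := hM.1.2 A hA B1 hB1 nA1
    have cE : (A.erase a).card = 2 := by rw [Finset.card_erase_of_mem ha, hA3]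
    have hM' := ex2 hM (A' := insert a B1) (B' := A.erase a) hA hB1 nA1
      (by rw [Finset.card_insert_of_notMem haB1, h21, hA3]) (by rw [cE, h21])
      (by
        intro z hz w hw
        rw [Finset.mem_insert] at hz hw
        rcases hz with rfl | hz <;> rcases hw with rfl | hw
        · exact G.irrefl
        · exact ee_zero.1 ha0 w hw
        · exact fun h => ee_zero.1 ha0 z hz h.symm
        · exact (hM.1.1 B1 hB1).2 z hz w hw)
      (fun z hz w hw => (hM.1.1 A hA).2 z (Finset.mem_of_mem_erase hz) w (Finset.mem_of_mem_erase hw))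
      (by
        rw [Finset.disjoint_insert_left]
        exact ⟨by simp, hdj.symm.mono_right (Finset.erase_subset _ _)⟩)
      (by
        intro Q hQ m1 m2
        have d1 := hM.1.2 A hA Q hQ m1.symm
        have d2 := hM.1.2 B1 hB1 Q hQ m2.symm
        rw [Finset.disjoint_insert_left]
        exact ⟨⟨Finset.disjoint_left.1 d1 ha, d2⟩, d1.mono_left (Finset.erase_subset _ _)⟩)
    have nB1 : B ≠ B1 := by rintro rfl; omega
    have nE : ({x, y} : Finset V) ≠ A.erase a := by
      intro h
      have : x ∈ A := Finset.mem_of_mem_erase (h ▸ (by simp : x ∈ ({x, y} : Finset V)))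
      exact hA0 (cls_uniq hM.1 hA hB0 this (by simp))
    refine hna (t0_mixed hn hdeg hs hM' (A := B) (B0 := {x, y}) (B := A.erase a) ?_ hB3 ?_ ?_ h20 cE nE (by simp : x ∈ _) ?_ hqB hp hq)
    · simp [hB, hAB.symm, nB1]
    · simp [hB0, hA0.symm, Ne.symm n1]
    · simp
    · simp [hpa, hpA]

end t0

theorem z_hit (hM : Mx G r s C) {u : V} (hu : u ∈ US C) {A : Finset V} (hA : A ∈ C) (hA3 : A.card = 3)
    (h0 : ee G u A = 0) {z x y : V} (hz : z ∈ insert u A) (hx : NT C x) (hy : NT C y) (hxu : x ≠ u)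
    (hyu : y ≠ u) (hxy : x ≠ y) (hn : ¬ G.Adj x y) : G.Adj z x ∨ G.Adj z y := by
  by_contra hc
  push Not at hc
  have huA : u ∉ A := mem_US.1 hu A hA
  have hxA := hx A hA hA3
  have hyA := hy A hA hA3
  have hZI : Ind G (insert u A) := by
    intro a ha b hb
    rw [Finset.mem_insert] at ha hb
    rcases ha with rfl | ha <;> rcases hb with rfl | hb
    · exact G.irrefl
    · exact ee_zero.1 h0 b hb
    · exact fun h => ee_zero.1 h0 a ha h.symm
    · exact (hM.1.1 A hA).2 a ha b hb
  have hZB : ∀ B ∈ C, B ≠ A → ∀ w ∈ insert u A, w ∉ B := by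
    intro B hB hne w hw hwB
    rw [Finset.mem_insert] at hw
    rcases hw with rfl | hw
    · exact mem_US.1 hu B hB hwB
    · exact hne (cls_uniq hM.1 hB hA hwB hw)
  have hzx : z ≠ x := by rintro rfl; rw [Finset.mem_insert] at hz; tauto
  have hzy : z ≠ y := by rintro rfl; rw [Finset.mem_insert] at hz; tauto
  refine gain1 hM hA {z, x, y} ((insert u A).erase z) ?_ (ind3 hc.1 hc.2 hn) ?_ ?_ ?_ ?_
  · rw [Finset.card_eq_three]; exact ⟨z, x, y, hzx, hzy, hxy, rfl⟩
  · rw [Finset.card_erase_of_mem hz, Finset.card_insert_of_notMem huA, hA3]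
  · exact fun a ha b hb => hZI a (Finset.mem_of_mem_erase ha) b (Finset.mem_of_mem_erase hb)
  · rw [Finset.disjoint_left]
    intro w hw
    simp only [Finset.mem_insert, Finset.mem_singleton] at hw
    rcases hw with rfl | rfl | rfl <;> simp [*]
  · intro B hB hB3 hne
    constructor
    · rw [Finset.disjoint_left]
      intro w hw
      simp only [Finset.mem_insert, Finset.mem_singleton] at hw
      rcases hw with rfl | rfl | rfl
      · exact hZB B hB hne _ hz
      · exact hx B hB hB3
      · exact hy B hB hB3
    · rw [Finset.disjoint_left]
      intro w hw
      exact hZB B hB hne _ (Finset.mem_of_mem_erase hw)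

theorem z_tight (hn : Fintype.card V = 3 * r + 2 * s + 1) (hdeg : ∀ v, G.degree v + 1 ≤ r + s + 1)
    (hM : Mx G r s C) {u : V} (hu : u ∈ US C) {A : Finset V} (hA : A ∈ C) (hA3 : A.card = 3)
    (h0 : ee G u A = 0) {x y p q : V} (hB : {x, y} ∈ C) (hB' : {p, q} ∈ C) (hxy : x ≠ y) (hpq : p ≠ q)
    (hne : ({x, y} : Finset V) ≠ {p, q}) :
    (∀ D ∈ C, D ≠ A → FF G x y p q D = 4) ∧
    (∀ z ∈ insert u A, wt G z x + wt G z y = 1 ∧ wt G z p + wt G z q = 1) ∧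
    G.degree x = r + s ∧ G.degree p = r + s := by
  have c1 : ({x, y} : Finset V).card = 2 := Finset.card_pair hxy
  have c2 : ({p, q} : Finset V).card = 2 := Finset.card_pair hpq
  have hUS : US C = {u} := by
    have := US_card hM hn
    rw [Finset.card_eq_one] at this
    obtain ⟨w, hw⟩ := this
    rw [hw] at hu ⊢
    rw [Finset.mem_singleton] at hu
    rw [hu]
  have huA : u ∉ A := mem_US.1 hu A hA
  have nu : ∀ B ∈ C, ∀ w ∈ B, w ≠ u := by
    rintro B hB w hw rfl
    exact mem_US.1 hu B hB hw
  have hz : ∀ x y, {x, y} ∈ C → x ≠ y → ∀ z ∈ insert u A, 1 ≤ wt G z x + wt G z y := by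
    intro x y hB hxy z hz
    have c1 : ({x, y} : Finset V).card = 2 := Finset.card_pair hxy
    rcases z_hit hM hu hA hA3 h0 hz (NT_pair hM.1 hB c1 (by simp : x ∈ _)) (NT_pair hM.1 hB c1 (by simp : y ∈ _))
      (nu _ hB x (by simp)) (nu _ hB y (by simp)) hxy ((hM.1.1 _ hB).2 x (by simp) y (by simp)) with h | h
    · rw [wt_one.2 h]; omega
    · rw [wt_one.2 h]; omega
  have zc : (insert u A).card = 4 := by rw [Finset.card_insert_of_notMem huA, hA3]
  have sw : ∀ x, ∑ z ∈ insert u A, wt G z x = ee G x A + ee G x (US C) := by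
    intro x
    rw [hUS, Finset.sum_insert huA]
    unfold ee
    rw [Finset.sum_singleton, wt_comm u x, Finset.sum_congr rfl (fun z _ => wt_comm z x)]
    omega
  have s1 := Finset.sum_le_sum (hz x y hB hxy)
  have s2 := Finset.sum_le_sum (hz p q hB' hpq)
  have s1' := s1
  have s2' := s2
  rw [Finset.sum_add_distrib, sw, sw] at s1' s2'
  simp only [Finset.sum_const, smul_eq_mul, mul_one, zc] at s1' s2'
  have n1 : A ≠ {x, y} := by rintro rfl; omega
  have n2 : A ≠ {p, q} := by rintro rfl; omega
  have hsum := FF_sum hM.1 hB hB'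
  rw [← Finset.add_sum_erase _ _ hA] at hsum
  have hFA : FF G x y p q A = ee G x A + ee G y A + (ee G p A + ee G q A) := by
    unfold FF
    rw [if_neg n1, if_neg n2]
    rfl
  have hge : ∀ D ∈ C.erase A, 4 ≤ FF G x y p q D := fun D hD => FF_ge hM hB hB' hxy hpq hne (Finset.mem_of_mem_erase hD)
  have h5 := Finset.sum_le_sum hge
  have h6 : ∑ D ∈ C.erase A, 4 = (C.erase A).card * 4 := by simp
  have h7 := Finset.card_erase_add_one hA
  have h4 := card_C hM.1
  rw [hM.2.1, hM.2.2.1] at h4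
  have dx := hdeg x
  have dy := hdeg y
  have dp := hdeg p
  have dq := hdeg q
  have e1 : ∑ D ∈ C.erase A, 4 = ∑ D ∈ C.erase A, FF G x y p q D := by omega
  have e2 : ∑ z ∈ insert u A, 1 = ∑ z ∈ insert u A, (wt G z x + wt G z y) := by
    rw [Finset.sum_add_distrib, sw, sw]
    simp only [Finset.sum_const, smul_eq_mul, mul_one, zc]
    omega
  have e3 : ∑ z ∈ insert u A, 1 = ∑ z ∈ insert u A, (wt G z p + wt G z q) := by
    rw [Finset.sum_add_distrib, sw, sw]
    simp only [Finset.sum_const, smul_eq_mul, mul_one, zc]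
    omega
  refine ⟨?_, ?_, by omega, by omega⟩
  · intro D hD hDA
    exact ((Finset.sum_eq_sum_iff_of_le hge).1 e1 D (Finset.mem_erase.2 ⟨hDA, hD⟩)).symm
  · intro z hz'
    exact ⟨((Finset.sum_eq_sum_iff_of_le (hz x y hB hxy)).1 e2 z hz').symm, ((Finset.sum_eq_sum_iff_of_le (hz p q hB' hpq)).1 e3 z hz').symm⟩

theorem z_core (hn : Fintype.card V = 3 * r + 2 * s + 1) (hdeg : ∀ v, G.degree v + 1 ≤ r + s + 1)
    (hM : Mx G r s C) {u : V} (hu : u ∈ US C) {A : Finset V} (hA : A ∈ C) (hA3 : A.card = 3)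
    (h0 : ee G u A = 0) {x y p q : V} (hB : {x, y} ∈ C) (hB' : {p, q} ∈ C) (hxy : x ≠ y) (hpq : p ≠ q)
    (hne : ({x, y} : Finset V) ≠ {p, q}) (hxp : G.Adj x p) : False := by
  obtain ⟨t1, t2, t3, t4⟩ := z_tight hn hdeg hM hu hA hA3 h0 hB hB' hxy hpq hne
  have c1 : ({x, y} : Finset V).card = 2 := Finset.card_pair hxy
  have c2 : ({p, q} : Finset V).card = 2 := Finset.card_pair hpq
  have hUS : US C = {u} := by
    have := US_card hM hn
    rw [Finset.card_eq_one] at this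
    obtain ⟨w, hw⟩ := this
    rw [hw] at hu ⊢
    rw [Finset.mem_singleton] at hu
    rw [hu]
  have huA : u ∉ A := mem_US.1 hu A hA
  have nu : ∀ B ∈ C, ∀ w ∈ B, w ≠ u := by
    rintro B hB w hw rfl
    exact mem_US.1 hu B hB hw
  have hnd := nd4 hM.1 hB hB' hxy hpq hne
  have hnd' := hnd
  simp only [List.nodup_cons, List.mem_cons, List.not_mem_nil, or_false, not_or, List.nodup_nil, not_false_eq_true, and_true] at hnd'
  obtain ⟨⟨_, xp, xq⟩, ⟨yp, yq⟩, _⟩ := hnd'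
  have hx := NT_pair hM.1 hB c1 (by simp : x ∈ _)
  have hy := NT_pair hM.1 hB c1 (by simp : y ∈ _)
  have hp := NT_pair hM.1 hB' c2 (by simp : p ∈ _)
  have hq := NT_pair hM.1 hB' c2 (by simp : q ∈ _)
  have n1 : A ≠ {x, y} := by rintro rfl; omega
  have n2 : A ≠ {p, q} := by rintro rfl; omega
  have g : ∀ D ∈ C, D.card = 2 → ∀ z B, B ∈ C → z ∈ B → D ≠ B → NT C z → 1 ≤ ee G z D := by
    intro D hD hD2 z B hB hz hne hzn
    exact ee_pair_ge hM hD hD2 hzn (fun h => hne (cls_uniq hM.1 hD hB h hz))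
  have hFB := t1 _ hB n1.symm
  have hFB' := t1 _ hB' n2.symm
  unfold FF at hFB hFB'
  rw [if_pos rfl] at hFB hFB'
  have exq : ee G x {p, q} = 1 := by
    have := g _ hB' c2 x _ hB (by simp) hne.symm hx
    have := g _ hB' c2 y _ hB (by simp) hne.symm hy
    omega
  have epx : ee G p {x, y} = 1 := by
    have := g _ hB c1 p _ hB' (by simp) hne hp
    have := g _ hB c1 q _ hB' (by simp) hne hq
    omega
  have hxq : ¬ G.Adj x q := fun h => hpq (ee_uniq exq.le (by simp) (by simp) hxp h)
  have hpy : ¬ G.Adj p y := fun h => hxy (ee_uniq epx.le (by simp) (by simp) hxp.symm h)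
  have hw : ∀ z ∈ insert u A, wt G z x = wt G z p := by
    intro z hz
    obtain ⟨k1, k2⟩ := t2 z hz
    have k3 : 1 ≤ wt G z x + wt G z q := by
      rcases z_hit hM hu hA hA3 h0 hz hx hq (nu _ hB x (by simp)) (nu _ hB' q (by simp)) xq hxq with h | h <;>
      · rw [wt_one.2 h]; omega
    have k4 : 1 ≤ wt G z p + wt G z y := by
      rcases z_hit hM hu hA hA3 h0 hz hp hy (nu _ hB' p (by simp)) (nu _ hB y (by simp)) (Ne.symm yp) hpy with h | h <;>
      · rw [wt_one.2 h]; omega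
    omega
  have hg : ∀ D ∈ C.erase A, ee G x D + ee G p D + ((if D = {x, y} then 1 else 0) + (if D = {p, q} then 1 else 0)) = 2 := by
    intro D hD
    rw [Finset.mem_erase] at hD
    have hF := t1 D hD.2 hD.1
    by_cases d1 : D = {x, y}
    · subst d1
      rw [if_pos rfl, if_neg hne, ee_self hM.1 hB (by simp), epx]
    · by_cases d2 : D = {p, q}
      · subst d2
        rw [if_pos rfl, if_neg hne.symm, ee_self hM.1 hB' (by simp : p ∈ _), exq]
      · unfold FF at hF
        rw [if_neg d1, if_neg d2] at hF ⊢
        rcases (hM.1.1 D hD.2).1 with h2 | h3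
        · have := g D hD.2 h2 x _ hB (by simp) d1 hx
          have := g D hD.2 h2 y _ hB (by simp) d1 hy
          have := g D hD.2 h2 p _ hB' (by simp) d2 hp
          have := g D hD.2 h2 q _ hB' (by simp) d2 hq
          omega
        · have := (tri_facts hM hD.2 h3 hnd hx hy hp hq ((hM.1.1 _ hB).2 x (by simp) y (by simp)) ((hM.1.1 _ hB').2 p (by simp) q (by simp))).2.1 hxq hpy (by omega)
          omega
  have hsum := Finset.sum_congr rfl hg
  rw [Finset.sum_add_distrib, Finset.sum_add_distrib, Finset.sum_add_distrib, Finset.sum_ite_eq', Finset.sum_ite_eq',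
    if_pos (Finset.mem_erase.2 ⟨n1.symm, hB⟩), if_pos (Finset.mem_erase.2 ⟨n2.symm, hB'⟩)] at hsum
  have dx := deg_eq hM.1 x
  have dp := deg_eq hM.1 p
  rw [← Finset.add_sum_erase _ _ hA] at dx dp
  have h7 := Finset.card_erase_add_one hA
  have h4 := card_C hM.1
  rw [hM.2.1, hM.2.2.1] at h4
  have h6 : ∑ D ∈ C.erase A, 2 = (C.erase A).card * 2 := by simp
  have sw : ∀ x, ee G x (insert u A) = ee G x A + ee G x (US C) := by
    intro x
    rw [hUS, ee_insert huA]
    unfold ee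
    rw [Finset.sum_singleton]
    omega
  have exz : ee G x (insert u A) = ee G p (insert u A) := by
    unfold ee
    refine Finset.sum_congr rfl fun z hz => ?_
    rw [wt_comm x, wt_comm p]
    exact hw z hz
  have ex2' : ee G x (insert u A) = 2 := by
    rw [sw, sw] at exz
    rw [sw]
    omega
  have zc : (insert u A).card = 4 := by rw [Finset.card_insert_of_notMem huA, hA3]
  have f1 : ((insert u A).filter (fun z => G.Adj x z)).card = 2 := by
    rw [← ex2', Finset.card_filter]
    unfold ee
    refine Finset.sum_congr rfl fun z _ => ?_
    by_cases h : G.Adj x z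
    · simp [h, wt_one.2 h]
    · simp [h, wt_zero.2 h]
  have f2 : ((insert u A).filter (fun z => ¬ G.Adj x z)).card = 2 := by
    have := Finset.card_filter_add_card_filter_not (s := insert u A) (fun z => G.Adj x z)
    omega
  have hZI : Ind G (insert u A) := by
    intro a ha b hb
    rw [Finset.mem_insert] at ha hb
    rcases ha with rfl | ha <;> rcases hb with rfl | hb
    · exact G.irrefl
    · exact ee_zero.1 h0 b hb
    · exact fun h => ee_zero.1 h0 a ha h.symm
    · exact (hM.1.1 A hA).2 a ha b hb
  have hZB : ∀ B ∈ C, B ≠ A → ∀ w ∈ insert u A, w ∉ B := by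
    intro B hB hne w hw hwB
    rw [Finset.mem_insert] at hw
    rcases hw with rfl | hw
    · exact mem_US.1 hu B hB hwB
    · exact hne (cls_uniq hM.1 hB hA hwB hw)
  have hxZ : x ∉ insert u A := fun h => hZB _ hB n1.symm x h (by simp)
  have hyZ : y ∉ insert u A := fun h => hZB _ hB n1.symm y h (by simp)
  have mk : ∀ w (S : Finset V), w ∉ insert u A → S ⊆ insert u A → S.card = 2 → (∀ z ∈ S, ¬ G.Adj w z) → NT C w →
      (insert w S).card = 3 ∧ Ind G (insert w S) ∧ ∀ B ∈ C, B.card = 3 → B ≠ A → Disjoint (insert w S) B := by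
    intro w S hwZ hS hS2 hadj hw
    refine ⟨?_, ?_, ?_⟩
    · rw [Finset.card_insert_of_notMem (fun h => hwZ (hS h)), hS2]
    · intro a ha b hb
      rw [Finset.mem_insert] at ha hb
      rcases ha with rfl | ha <;> rcases hb with rfl | hb
      · exact G.irrefl
      · exact hadj b hb
      · exact fun h => hadj a ha h.symm
      · exact hZI a (hS ha) b (hS hb)
    · intro B hB hB3 hne
      rw [Finset.disjoint_insert_left, Finset.disjoint_left]
      exact ⟨hw B hB hB3, fun z hz => hZB B hB hne z (hS hz)⟩
  obtain ⟨a1, a2, a3⟩ := mk y _ hyZ (Finset.filter_subset (fun z => G.Adj x z) _) f1 (by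
    intro z hz hyz
    rw [Finset.mem_filter] at hz
    have := (t2 z hz.1).1
    rw [wt_one.2 hz.2.symm, wt_one.2 hyz.symm] at this
    omega) hy
  obtain ⟨b1, b2, b3⟩ := mk x _ hxZ (Finset.filter_subset (fun z => ¬ G.Adj x z) _) f2 (by
    intro z hz
    rw [Finset.mem_filter] at hz
    exact hz.2) hx
  refine gain1 hM hA _ _ a1 a2 b1 b2 ?_ (fun B h1 h2 h3 => ⟨a3 B h1 h2 h3, b3 B h1 h2 h3⟩)
  rw [Finset.disjoint_left]
  intro w hw hw'
  rw [Finset.mem_insert, Finset.mem_filter] at hw hw'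
  rcases hw with rfl | hw <;> rcases hw' with rfl | hw'
  · exact hxy rfl
  · exact hyZ hw'.1
  · exact hxZ hw.1
  · exact hw'.2 hw.2

theorem z_lemma (hn : Fintype.card V = 3 * r + 2 * s + 1) (hdeg : ∀ v, G.degree v + 1 ≤ r + s + 1)
    (hs : 2 ≤ s) (hM : Mx G r s C) {u : V} (hu : u ∈ US C) {A : Finset V} (hA : A ∈ C) (hA3 : A.card = 3) :
    1 ≤ ee G u A := by
  by_contra h0
  have h0 : ee G u A = 0 := by omega
  obtain ⟨B0, hB0, h20, -⟩ := more_pairs hM ∅ (by simp; omega)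
  obtain ⟨B1, hB1, h21, n1⟩ := more_pairs hM {B0} (by simp; omega)
  rw [Finset.mem_singleton] at n1
  obtain ⟨x, y, hxy, rfl⟩ := Finset.card_eq_two.1 h20
  obtain ⟨z, hz, hxz⟩ := ee_pos.1 (ee_pair_ge hM hB1 h21 (NT_pair hM.1 hB0 h20 (by simp : x ∈ _))
    (fun h => n1 (cls_uniq hM.1 hB1 hB0 h (by simp))))
  obtain ⟨p, q, hpq, rfl⟩ := Finset.card_eq_two.1 h21
  simp only [Finset.mem_insert, Finset.mem_singleton] at hz
  rcases hz with rfl | rfl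
  · exact z_core hn hdeg hM hu hA hA3 h0 hB0 hB1 hxy hpq (Ne.symm n1) hxz
  · rw [Finset.pair_comm] at hB1 n1
    exact z_core hn hdeg hM hu hA hA3 h0 hB0 hB1 hxy hpq.symm (Ne.symm n1) hxz

theorem t1_one (hn : Fintype.card V = 3 * r + 2 * s + 1) (hdeg : ∀ v, G.degree v + 1 ≤ r + s + 1)
    (hs : 2 ≤ s) (hM : Mx G r s C) {u : V} (hu : u ∈ US C) :
    (∀ A ∈ C, ee G u A = 1) ∧ G.degree u + 1 = r + s + 1 := by
  refine one_of hM hn hdeg hu ?_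
  intro A hA
  rcases (hM.1.1 A hA).1 with h2 | h3
  · exact ee_pair_ge hM hA h2 (NT_US hu) (mem_US.1 hu A hA)
  · exact z_lemma hn hdeg hs hM hu hA h3

theorem ind_insert {a : V} {S : Finset V} (hS : Ind G S) (h : ∀ z ∈ S, ¬ G.Adj a z) : Ind G (insert a S) := by
  intro x hx y hy
  rw [Finset.mem_insert] at hx hy
  rcases hx with rfl | hx <;> rcases hy with rfl | hy
  · exact G.irrefl
  · exact h y hy
  · exact fun h' => h x hx h'.symm
  · exact hS x hx y hy

theorem rot (hn : Fintype.card V = 3 * r + 2 * s + 1) (hdeg : ∀ v, G.degree v + 1 ≤ r + s + 1)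
    (hs : 2 ≤ s) (hM : Mx G r s C) {u : V} (hu : u ∈ US C) {A B A' B' : Finset V} (hA : A ∈ C) (hB : B ∈ C)
    (hne : A ≠ B) (cA : A'.card = A.card) (cB : B'.card = B.card) (iA : Ind G A') (iB : Ind G B')
    (hd : Disjoint A' B') (hA' : ∀ w ∈ A', w ∈ A ∨ w ∈ B ∨ w = u) (hB' : ∀ w ∈ B', w ∈ A ∨ w ∈ B ∨ w = u)
    {v : V} (hv : v ∈ A ∨ v ∈ B ∨ v = u) (hvA : v ∉ A') (hvB : v ∉ B') :
    ee G v A' = 1 ∧ ee G v B' = 1 ∧ ∀ Q ∈ C, Q ≠ A → Q ≠ B → ee G v Q = 1 ∧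
      ∀ z ∈ Q, G.Adj z v → ee G z A' = 1 ∧ ee G z B' = 1 := by
  have key : ∀ w, (w ∈ A ∨ w ∈ B ∨ w = u) → ∀ Q ∈ C, Q ≠ A → Q ≠ B → w ∉ Q := by
    intro w hw Q hQ n1 n2 hwQ
    rcases hw with h | h | rfl
    · exact n1 (cls_uniq hM.1 hQ hA hwQ h)
    · exact n2 (cls_uniq hM.1 hQ hB hwQ h)
    · exact mem_US.1 hu Q hQ hwQ
  have hM' := ex2 hM hA hB hne cA cB iA iB hd (by
    intro Q hQ n1 n2
    rw [Finset.disjoint_left, Finset.disjoint_left]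
    exact ⟨fun w hw => key w (hA' w hw) Q hQ n1 n2, fun w hw => key w (hB' w hw) Q hQ n1 n2⟩)
  set C' := insert A' (insert B' ((C.erase A).erase B)) with hC'
  have mA : A' ∈ C' := by simp [hC']
  have mB : B' ∈ C' := by simp [hC']
  have mQ : ∀ Q ∈ C, Q ≠ A → Q ≠ B → Q ∈ C' := by
    intro Q hQ n1 n2
    simp [hC', hQ, n1, n2]
  have hvU : v ∈ US C' := by
    rw [mem_US]
    intro Q hQ
    rw [hC', Finset.mem_insert, Finset.mem_insert, Finset.mem_erase, Finset.mem_erase] at hQ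
    rcases hQ with rfl | rfl | hQ
    · exact hvA
    · exact hvB
    · exact key v hv Q hQ.2.2 hQ.2.1 hQ.1
  have o1 := (t1_one hn hdeg hs hM' hvU).1
  refine ⟨o1 _ mA, o1 _ mB, ?_⟩
  intro Q hQ n1 n2
  have oQ := o1 Q (mQ Q hQ n1 n2)
  refine ⟨oQ, ?_⟩
  intro z hz hzv
  obtain ⟨C2, hM2, -, h2, h3⟩ := ex1 hM' (mQ Q hQ n1 n2) hz hvU (by
    intro x hx hne hvx
    exact hne (ee_uniq oQ.le hx hz hvx hzv.symm))
  have o2 := (t1_one hn hdeg hs hM2 (u := z) (by rw [h2]; simp)).1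
  refine ⟨o2 _ (h3 _ mA ?_), o2 _ (h3 _ mB ?_)⟩
  · rintro rfl
    exact key z (hA' z hz) _ hQ n1 n2 hz
  · rintro rfl
    exact key z (hB' z hz) _ hQ n1 n2 hz

theorem rot5 (hn : Fintype.card V = 3 * r + 2 * s + 1) (hdeg : ∀ v, G.degree v + 1 ≤ r + s + 1)
    (hs : 2 ≤ s) (hM : Mx G r s C) {u : V} (hu : u ∈ US C) {x y p q : V} {R : Finset V}
    (hB : {x, y} ∈ C) (hP : insert p (insert q R) ∈ C) (hne : ({x, y} : Finset V) ≠ insert p (insert q R))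
    (hnd : [x, y, p, q, u].Nodup) (hR : ∀ w ∈ [x, y, p, q, u], w ∉ R)
    (a b c d v : V) (hm : ∀ w ∈ [a, b, c, d, v], w ∈ [x, y, p, q, u]) (hnd2 : [a, b, c, d, v].Nodup)
    (hab : ¬ G.Adj a b) (hcd : ¬ G.Adj c d) (hc : ∀ w ∈ R, ¬ G.Adj c w) (hd : ∀ w ∈ R, ¬ G.Adj d w) :
    wt G v a + wt G v b = 1 ∧ wt G v c + (wt G v d + ee G v R) = 1 ∧
    ∀ Q ∈ C, Q ≠ {x, y} → Q ≠ insert p (insert q R) → ee G v Q = 1 ∧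
      ∀ z ∈ Q, G.Adj z v → wt G z a + wt G z b = 1 ∧ wt G z c + (wt G z d + ee G z R) = 1 := by
  have hR2 : ∀ w ∈ [a, b, c, d, v], w ∉ R := fun w hw => hR w (hm w hw)
  have hIR : Ind G R := fun w hw z hz => (hM.1.1 _ hP).2 w (by simp [hw]) z (by simp [hz])
  simp only [List.nodup_cons, List.mem_cons, List.not_mem_nil, or_false, not_or, List.nodup_nil, not_false_eq_true, and_true] at hnd hnd2
  obtain ⟨⟨ab, ac, ad, av⟩, ⟨bc, bd, bv⟩, ⟨cd, cv⟩, dv⟩ := hnd2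
  simp only [List.mem_cons, List.not_mem_nil, or_false, forall_eq_or_imp, forall_eq] at hR hR2
  obtain ⟨ra, rb, rc, rd, rv⟩ := hR2
  obtain ⟨rx, ry, rp, rq, ru⟩ := hR
  have hmm : ∀ w ∈ [a, b, c, d, v], w ∈ ({x, y} : Finset V) ∨ w ∈ insert p (insert q R) ∨ w = u := by
    intro w hw
    have := hm w hw
    simp only [List.mem_cons, List.not_mem_nil, or_false] at this
    simp only [Finset.mem_insert, Finset.mem_singleton]
    tauto
  simp only [List.mem_cons, List.not_mem_nil, or_false, forall_eq_or_imp, forall_eq] at hmm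
  obtain ⟨ma, mb, mc, md, mv⟩ := hmm
  have h := rot hn hdeg hs hM hu (A' := {a, b}) (B' := insert c (insert d R)) hB hP hne
    (by rw [Finset.card_pair ab, Finset.card_pair hnd.1.1])
    (by rw [Finset.card_insert_of_notMem (by simp [cd, rc]), Finset.card_insert_of_notMem rd,
        Finset.card_insert_of_notMem (by simp [hnd.2.2.1.1, rp]), Finset.card_insert_of_notMem rq])
    (ind2 hab) (ind_insert (ind_insert hIR hd) (by
      intro z hz
      rw [Finset.mem_insert] at hz
      rcases hz with rfl | hz
      · exact hcd
      · exact hc z hz))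
    (by
      rw [Finset.disjoint_left]
      intro w hw
      simp only [Finset.mem_insert, Finset.mem_singleton] at hw
      rcases hw with rfl | rfl <;> simp [*])
    (by
      intro w hw
      simp only [Finset.mem_insert, Finset.mem_singleton] at hw
      rcases hw with rfl | rfl <;> assumption)
    (by
      intro w hw
      rw [Finset.mem_insert, Finset.mem_insert] at hw
      rcases hw with rfl | rfl | hw
      · exact mc
      · exact md
      · exact Or.inr (Or.inl (by simp [hw])))
    mv (by simp [Ne.symm av, Ne.symm bv]) (by simp [Ne.symm cv, Ne.symm dv, rv])
  have ecd : ∀ z, ee G z (insert c (insert d R)) = wt G z c + (wt G z d + ee G z R) := by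
    intro z
    rw [ee_insert (by simp [cd, rc]), ee_insert rd]
  simp only [ee_pair ab, ecd] at h
  exact h

theorem nd_of {x y p q u : V} (hnd : [x, y, p, q, u].Nodup) : [u, x, p, q, y].Nodup ∧
    [x, y, u, q, p].Nodup ∧
    [u, x, y, p, q].Nodup ∧
    [p, y, u, q, x].Nodup ∧
    [p, q, x, y, u].Nodup ∧
    [u, q, p, y, x].Nodup := by
  simp only [List.nodup_cons, List.mem_cons, List.not_mem_nil, or_false, not_or, List.nodup_nil, not_false_eq_true, and_true] at hnd ⊢
  obtain ⟨⟨xy, xp, xq, xu⟩, ⟨yp, yq, yu⟩, ⟨pq, pu⟩, qu⟩ := hnd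
  simp [xy, xp, xq, xu, yp, yq, yu, pq, pu, qu, Ne.symm xy, Ne.symm xp, Ne.symm xq, Ne.symm xu, Ne.symm yp, Ne.symm yq, Ne.symm yu,
    Ne.symm pq, Ne.symm pu, Ne.symm qu]

theorem five (hn : Fintype.card V = 3 * r + 2 * s + 1) (hdeg : ∀ v, G.degree v + 1 ≤ r + s + 1)
    (hs : 2 ≤ s) (h3 : 3 ≤ r + s) (hM : Mx G r s C) {u : V} (hu : u ∈ US C) {x y p q : V} {R : Finset V}
    (hB : {x, y} ∈ C) (hP : insert p (insert q R) ∈ C) (hne : ({x, y} : Finset V) ≠ insert p (insert q R))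
    (hnd : [x, y, p, q, u].Nodup) (hR : ∀ w ∈ [x, y, p, q, u], w ∉ R)
    (hup : G.Adj u p) (huy : G.Adj u y) (hyq : G.Adj y q) (hyp : ¬ G.Adj y p) : False := by
  have ou := (t1_one hn hdeg hs hM hu).1
  have main := rot5 hn hdeg hs hM hu hB hP hne hnd hR
  obtain ⟨nd1, nd2, nd3, nd4, nd5, nd6⟩ := nd_of hnd
  have hnd' := hnd
  simp only [List.nodup_cons, List.mem_cons, List.not_mem_nil, or_false, not_or, List.nodup_nil, not_false_eq_true, and_true] at hnd'
  obtain ⟨⟨xy, xp, xq, xu⟩, ⟨yp, yq, yu⟩, ⟨pq, pu⟩, qu⟩ := hnd'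
  have rp : p ∉ R := hR p (by simp)
  have rq : q ∉ R := hR q (by simp)
  have iP := (hM.1.1 _ hP).2
  have hux : ¬ G.Adj u x := fun h => xy (ee_uniq (ou _ hB).le (by simp) (by simp) h huy)
  have huq : ¬ G.Adj u q := fun h => pq (ee_uniq (ou _ hP).le (by simp) (by simp) hup h)
  have huR : ∀ w ∈ R, ¬ G.Adj u w := fun w hw h => rp (by
    rw [ee_uniq (ou _ hP).le (by simp) (by simp [hw]) hup h]; exact hw)
  have hxy : ¬ G.Adj x y := (hM.1.1 _ hB).2 x (by simp) y (by simp)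
  have hpq : ¬ G.Adj p q := iP p (by simp) q (by simp)
  have hpR : ∀ w ∈ R, ¬ G.Adj p w := fun w hw => iP p (by simp) w (by simp [hw])
  have hqR : ∀ w ∈ R, ¬ G.Adj q w := fun w hw => iP q (by simp) w (by simp [hw])
  have hxu : ¬ G.Adj x u := fun h => hux h.symm
  have hpy : ¬ G.Adj p y := fun h => hyp h.symm
  -- C2
  obtain ⟨-, a2, C2⟩ := main u x p q y (by simp) nd1 hux hpq hpR hqR
  have hyR : ∀ w ∈ R, ¬ G.Adj y w := by
    rw [← ee_zero]
    rw [wt_one.2 hyq] at a2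
    omega
  obtain ⟨a1, -, C1⟩ := main x y u q p (by simp) nd2 hxy huq huR hqR
  obtain ⟨a3, -, C3⟩ := main u x y p q (by simp) nd3 hux hyp hyR hpR
  have hqx : G.Adj q x := by
    rw [wt_zero.2 (fun h => huq h.symm)] at a3
    exact wt_one.1 (by omega)
  obtain ⟨-, a4, C4⟩ := main p y u q x (by simp) nd4 hpy huq huR hqR
  have hxR : ∀ w ∈ R, ¬ G.Adj x w := by
    rw [← ee_zero]
    rw [wt_one.2 hqx.symm] at a4
    omega
  obtain ⟨-, -, C0⟩ := main x y p q u (by simp) hnd hxy hpq hpR hqR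
  obtain ⟨-, -, C0'⟩ := main p q x y u (by simp) nd5 hpq hxy hxR hyR
  obtain ⟨-, -, C4'⟩ := main u q p y x (by simp) nd6 huq hpy hpR hyR
  have h4 := card_C hM.1
  rw [hM.2.1, hM.2.2.1] at h4
  obtain ⟨Q, hQ, hQn⟩ := Finset.exists_mem_notMem_of_card_lt_card (s := {{x, y}, insert p (insert q R)}) (t := C)
    (lt_of_le_of_lt Finset.card_le_two (by omega))
  simp only [Finset.mem_insert, Finset.mem_singleton, not_or] at hQn
  obtain ⟨e0, C0⟩ := C0 Q hQ hQn.1 hQn.2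
  obtain ⟨_, C0'⟩ := C0' Q hQ hQn.1 hQn.2
  obtain ⟨e1, C1⟩ := C1 Q hQ hQn.1 hQn.2
  obtain ⟨e2, C2⟩ := C2 Q hQ hQn.1 hQn.2
  obtain ⟨e3, C3⟩ := C3 Q hQ hQn.1 hQn.2
  obtain ⟨e4, C4⟩ := C4 Q hQ hQn.1 hQn.2
  obtain ⟨_, C4'⟩ := C4' Q hQ hQn.1 hQn.2
  have hdv : 3 ∣ ∑ z ∈ Q, (wt G z u + wt G z p + wt G z x + wt G z q + wt G z y) := by
    refine Finset.dvd_sum fun z hz => ?_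
    have k0 := C0 z hz
    have k0' := C0' z hz
    have k1 := C1 z hz
    have k2 := C2 z hz
    have k3 := C3 z hz
    have k4 := C4 z hz
    have k4' := C4' z hz
    rw [← wt_one] at k0 k0' k1 k2 k3 k4 k4'
    have wu := wt_le (G := G) z u
    have wp := wt_le (G := G) z p
    have wx := wt_le (G := G) z x
    have wq := wt_le (G := G) z q
    have wy := wt_le (G := G) z y
    omega
  have sw : ∀ v, ∑ z ∈ Q, wt G z v = ee G v Q := by
    intro v
    unfold ee
    exact Finset.sum_congr rfl fun z _ => wt_comm z v
  rw [Finset.sum_add_distrib, Finset.sum_add_distrib, Finset.sum_add_distrib, Finset.sum_add_distrib,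
    sw, sw, sw, sw, sw, e0, e1, e2, e3, e4] at hdv
  omega

theorem t1_claim (hn : Fintype.card V = 3 * r + 2 * s + 1) (hdeg : ∀ v, G.degree v + 1 ≤ r + s + 1)
    (hs : 2 ≤ s) (h3 : 3 ≤ r + s) (hM : Mx G r s C) {u : V} (hu : u ∈ US C) {y p : V} {B P : Finset V}
    (hB : B ∈ C) (hB2 : B.card = 2) (hy : y ∈ B) (hP : P ∈ C) (hne : B ≠ P) (hp : p ∈ P)
    (huy : G.Adj u y) (hup : G.Adj u p) : G.Adj y p := by
  by_contra hyp
  have ou := (t1_one hn hdeg hs hM hu).1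
  obtain ⟨x, xy, rfl⟩ : ∃ x, x ≠ y ∧ B = {x, y} := by
    obtain ⟨a, b, hab, rfl⟩ := Finset.card_eq_two.1 hB2
    simp only [Finset.mem_insert, Finset.mem_singleton] at hy
    rcases hy with rfl | rfl
    · exact ⟨b, hab.symm, Finset.pair_comm _ _⟩
    · exact ⟨a, hab, rfl⟩
  have uB : u ∉ ({x, y} : Finset V) := mem_US.1 hu _ hB
  have uP : u ∉ P := mem_US.1 hu _ hP
  have xP : x ∉ P := fun h => hne (cls_uniq hM.1 hB hP (by simp) h)
  have yP : y ∉ P := fun h => hne (cls_uniq hM.1 hB hP (by simp) h)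
  have hux : ¬ G.Adj u x := fun h => xy (ee_uniq (ou _ hB).le (by simp) (by simp) h huy)
  simp only [Finset.mem_insert, Finset.mem_singleton, not_or] at uB
  have h := (rot hn hdeg hs hM hu (A' := {u, x}) (B' := P) (v := y) hB hP hne
    (by rw [Finset.card_pair uB.1, hB2]) rfl (ind2 hux) (hM.1.1 _ hP).2
    (by simp [Finset.disjoint_left, uP, xP])
    (by simp) (by intro w hw; exact Or.inr (Or.inl hw)) (by simp)
    (by simp [Ne.symm uB.2, Ne.symm xy]) yP).2.1
  obtain ⟨q, hq, hyq⟩ := ee_pos.1 h.ge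
  have hqp : q ≠ p := by rintro rfl; exact hyp hyq
  have hPe : P = insert p (insert q ((P.erase p).erase q)) := by
    rw [Finset.insert_erase (by simp [hqp, hq]), Finset.insert_erase hp]
  have xp : x ≠ p := by rintro rfl; exact xP hp
  have xq : x ≠ q := by rintro rfl; exact xP hq
  have yp : y ≠ p := by rintro rfl; exact yP hp
  have yq : y ≠ q := by rintro rfl; exact yP hq
  have pu : p ≠ u := by rintro rfl; exact uP hp
  have qu : q ≠ u := by rintro rfl; exact uP hq
  refine five hn hdeg hs h3 hM hu (R := (P.erase p).erase q) hB (hPe ▸ hP) (hPe ▸ hne) ?_ ?_ hup huy hyq hyp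
  · simp [xy, xp, xq, Ne.symm uB.1, yp, yq, Ne.symm uB.2, hqp.symm, pu, qu]
  · simp [xP, yP, uP]

theorem case_t1 (hn : Fintype.card V = 3 * r + 2 * s + 1) (hdeg : ∀ v, G.degree v + 1 ≤ r + s + 1)
    (hs : 2 ≤ s) (h3 : 3 ≤ r + s) (hM : Mx G r s C)
    (hnk : ∀ u, G.degree u + 1 = r + s + 1 → ∃ p q, G.Adj u p ∧ G.Adj u q ∧ p ≠ q ∧ ¬ G.Adj p q) :
    False := by
  have hc := US_card hM hn
  obtain ⟨u, hU⟩ := Finset.card_eq_one.1 hc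
  have hu : u ∈ US C := by rw [hU]; simp
  obtain ⟨ou, hd⟩ := t1_one hn hdeg hs hM hu
  obtain ⟨p, q, hp, hq, hpq, hna⟩ := hnk u hd
  have cl : ∀ p, G.Adj u p → ∃ A ∈ C, p ∈ A := by
    intro p hp
    have h : p ∉ US C := by rw [hU, Finset.mem_singleton]; exact hp.ne'
    rw [mem_US] at h; push Not at h
    exact h
  obtain ⟨A, hA, hpA⟩ := cl p hp
  obtain ⟨B, hB, hqB⟩ := cl q hq
  have hAB : A ≠ B := by
    rintro rfl
    exact hpq (ee_uniq (ou A hA).le hpA hqB hp hq)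
  have sw : ∀ A ∈ C, ∀ q ∈ A, G.Adj u q →
      ∃ C', Mx G r s C' ∧ insert u (A.erase q) ∈ C' ∧ US C' = insert q ((US C).erase u) ∧
      ∀ Q ∈ C, Q ≠ A → Q ∈ C' := by
    intro A hA q hq huq
    refine ex1 hM hA hq hu ?_
    intro x hx hne hux
    exact hne (ee_uniq (ou A hA).le hx hq hux huq)
  rcases (hM.1.1 A hA).1 with hA2 | hA3
  · exact hna (t1_claim hn hdeg hs h3 hM hu hA hA2 hpA hB hAB hqB hp hq)
  rcases (hM.1.1 B hB).1 with hB2 | hB3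
  · exact hna (t1_claim hn hdeg hs h3 hM hu hB hB2 hqB hA hAB.symm hpA hq hp).symm
  obtain ⟨D, hD, hD2, -⟩ := more_pairs hM ∅ (by simp; omega)
  have nAD : A ≠ D := by rintro rfl; omega
  have nBD : B ≠ D := by rintro rfl; omega
  obtain ⟨y, hy, huy⟩ := ee_pos.1 (ou D hD).ge
  have yp := t1_claim hn hdeg hs h3 hM hu hD hD2 hy hA nAD.symm hpA huy hp
  have yq := t1_claim hn hdeg hs h3 hM hu hD hD2 hy hB nBD.symm hqB huy hq
  obtain ⟨C1, hM1, -, hU1, m1⟩ := sw A hA p hpA hp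
  have hp1 : p ∈ US C1 := by rw [hU1]; simp
  obtain ⟨q', hq', hpq'⟩ := ee_pos.1 ((t1_one hn hdeg hs hM1 hp1).1 B (m1 B hB hAB.symm)).ge
  have yq' := t1_claim hn hdeg hs h3 hM1 hp1 (m1 D hD nAD.symm) hD2 hy (m1 B hB hAB.symm) nBD.symm hq' yp.symm hpq'
  obtain ⟨C2, hM2, -, hU2, m2⟩ := sw D hD y hy huy
  have hy2 : y ∈ US C2 := by rw [hU2]; simp
  have := ee_uniq ((t1_one hn hdeg hs hM2 hy2).1 B (m2 B hB nBD)).le hq' hqB yq' yq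
  subst this
  exact hna hpq'

theorem toRST (hC : Conf G C) :
    IsRST G (C ∪ (US C).image (fun v => {v})) (c3 C) (c2 C) (US C).card := by
  have hcard : ∀ A ∈ C, A.card = 2 ∨ A.card = 3 := fun A hA => (hC.1 A hA).1
  have him : ∀ A, A ∈ (US C).image (fun v => ({v} : Finset V)) ↔ ∃ v ∈ US C, {v} = A := by
    intro A; simp
  refine ⟨?_, ?_, ?_, ?_, ?_, ?_⟩
  · intro v
    by_cases hv : v ∈ US C
    · refine ⟨{v}, ⟨?_, by simp⟩, ?_⟩
      · rw [Finset.mem_union, him]; exact Or.inr ⟨v, hv, rfl⟩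
      · rintro A ⟨hA, hvA⟩
        rw [Finset.mem_union, him] at hA
        rcases hA with hA | ⟨w, hw, rfl⟩
        · exact absurd hvA (mem_US.1 hv A hA)
        · rw [Finset.mem_singleton] at hvA; rw [hvA]
    · have hv' := hv
      rw [mem_US] at hv'
      push Not at hv'
      obtain ⟨A, hA, hvA⟩ := hv'
      refine ⟨A, ⟨Finset.mem_union_left _ hA, hvA⟩, ?_⟩
      rintro B ⟨hB, hvB⟩
      rw [Finset.mem_union, him] at hB
      rcases hB with hB | ⟨w, hw, rfl⟩
      · exact cls_uniq hC hB hA hvB hvA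
      · rw [Finset.mem_singleton] at hvB; rw [hvB] at hv; exact absurd hw hv
  · intro A hA
    rw [Finset.mem_union, him] at hA
    rcases hA with hA | ⟨w, hw, rfl⟩
    · exact (hC.1 A hA).2
    · intro a ha b hb
      rw [Finset.mem_singleton] at ha hb
      rw [ha, hb]
      exact G.irrefl
  · unfold c3
    congr 1
    ext A
    simp only [Finset.mem_filter, Finset.mem_union, him]
    constructor
    · rintro ⟨h | ⟨w, hw, rfl⟩, h3⟩
      · exact ⟨h, h3⟩
      · simp at h3
    · rintro ⟨h, h3⟩
      exact ⟨Or.inl h, h3⟩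
  · unfold c2
    congr 1
    ext A
    simp only [Finset.mem_filter, Finset.mem_union, him]
    constructor
    · rintro ⟨h | ⟨w, hw, rfl⟩, h3⟩
      · exact ⟨h, h3⟩
      · simp at h3
    · rintro ⟨h, h3⟩
      exact ⟨Or.inl h, h3⟩
  · rw [← Finset.card_image_of_injective (US C) (f := fun v => ({v} : Finset V)) Finset.singleton_injective]
    congr 1
    ext A
    simp only [Finset.mem_filter, Finset.mem_union, him]
    constructor
    · rintro ⟨h | h, h1⟩
      · have := hcard A h; omega
      · exact h
    · intro h
      refine ⟨Or.inr h, ?_⟩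
      obtain ⟨w, hw, rfl⟩ := h
      simp
  · intro A hA
    rw [Finset.mem_union, him] at hA
    rcases hA with hA | ⟨w, hw, rfl⟩
    · exact Or.inr (hcard A hA)
    · left; simp

theorem fromRST {P : Finset (Finset V)} {t : ℕ} (h : IsMaxRST G P r s t) :
    Mx G r s (P.filter (fun A => A.card ≠ 1)) ∧ Fintype.card V = 3 * r + 2 * s + t := by
  obtain ⟨⟨h1, h2, h3, h4, h5, h6⟩, h7⟩ := h
  have hconf : Conf G (P.filter (fun A => A.card ≠ 1)) := by
    constructor
    · intro A hA
      rw [Finset.mem_filter] at hA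
      have := h6 A hA.1
      exact ⟨by tauto, h2 A hA.1⟩
    · intro A hA B hB hne
      rw [Finset.mem_filter] at hA hB
      rw [Finset.disjoint_left]
      intro v hvA hvB
      exact hne ((h1 v).unique ⟨hA.1, hvA⟩ ⟨hB.1, hvB⟩)
  have e3 : c3 (P.filter (fun A => A.card ≠ 1)) = r := by
    rw [← h3]
    unfold c3
    rw [Finset.filter_filter]
    congr 1
    ext A
    simp only [Finset.mem_filter]
    constructor
    · rintro ⟨a, b, c⟩; exact ⟨a, c⟩
    · rintro ⟨a, c⟩; exact ⟨a, by omega, c⟩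
  have e2 : c2 (P.filter (fun A => A.card ≠ 1)) = s := by
    rw [← h4]
    unfold c2
    rw [Finset.filter_filter]
    congr 1
    ext A
    simp only [Finset.mem_filter]
    constructor
    · rintro ⟨a, b, c⟩; exact ⟨a, c⟩
    · rintro ⟨a, c⟩; exact ⟨a, by omega, c⟩
  have e1 : (US (P.filter (fun A => A.card ≠ 1))).card = t := by
    rw [← h5, ← Finset.card_image_of_injective (US _) (f := fun v => ({v} : Finset V)) Finset.singleton_injective]
    congr 1
    ext A
    simp only [Finset.mem_image, Finset.mem_filter]
    constructor
    · rintro ⟨v, hv, rfl⟩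
      obtain ⟨A, ⟨hA, hvA⟩, -⟩ := h1 v
      by_cases hc : A.card = 1
      · obtain ⟨w, rfl⟩ := Finset.card_eq_one.1 hc
        rw [Finset.mem_singleton] at hvA
        rw [hvA]
        exact ⟨hA, hc⟩
      · exact absurd hvA (mem_US.1 hv A (Finset.mem_filter.2 ⟨hA, hc⟩))
    · rintro ⟨hA, hc⟩
      obtain ⟨w, rfl⟩ := Finset.card_eq_one.1 hc
      refine ⟨w, ?_, rfl⟩
      rw [mem_US]
      intro B hB hwB
      rw [Finset.mem_filter] at hB
      have := (h1 w).unique ⟨hB.1, hwB⟩ ⟨hA, by simp⟩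
      rw [this] at hB
      exact hB.2 hc
  refine ⟨⟨hconf, e3, e2, fun C' hC' => h7 _ _ _ _ (toRST hC')⟩, ?_⟩
  rw [card_V hconf, e3, e2, e1]

theorem nk (hcomp : ∀ K : G.ConnectedComponent,
      ¬ (K.supp.ncard = G.maxDegree + 1 ∧
         ∀ u ∈ K.supp, ∀ v ∈ K.supp, u ≠ v → G.Adj u v)) {u : V} (hu : G.degree u = G.maxDegree) :
    ∃ p q, G.Adj u p ∧ G.Adj u q ∧ p ≠ q ∧ ¬ G.Adj p q := by
  by_contra hc
  push Not at hc
  set N := insert u (G.neighborFinset u) with hN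
  have hNc : N.card = G.maxDegree + 1 := by
    rw [hN, Finset.card_insert_of_notMem (by simp), G.card_neighborFinset_eq_degree, hu]
  have hcl : ∀ a ∈ N, ∀ b ∈ N, a ≠ b → G.Adj a b := by
    intro a ha b hb hab
    rw [hN, Finset.mem_insert, G.mem_neighborFinset] at ha hb
    rcases ha with rfl | ha <;> rcases hb with rfl | hb
    · exact absurd rfl hab
    · exact hb
    · exact ha.symm
    · exact hc a b ha hb hab
  have hclosed : ∀ a ∈ N, ∀ b, G.Adj a b → b ∈ N := by
    intro a ha b hab
    have hsub : N.erase a ⊆ G.neighborFinset a := by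
      intro w hw
      rw [Finset.mem_erase] at hw
      rw [G.mem_neighborFinset]
      exact hcl a ha w hw.2 hw.1.symm
    have heq := Finset.eq_of_subset_of_card_le hsub (by
      rw [G.card_neighborFinset_eq_degree, Finset.card_erase_of_mem ha, hNc]
      exact G.degree_le_maxDegree a)
    have : b ∈ N.erase a := by rw [heq, G.mem_neighborFinset]; exact hab
    exact Finset.mem_of_mem_erase this
  have hw : ∀ a b, G.Walk a b → a ∈ N → b ∈ N := by
    intro a b w
    induction w with
    | nil => exact id
    | cons h _ ih => exact fun ha => ih (hclosed _ ha _ h)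
  have hsupp : (G.connectedComponentMk u).supp = (N : Set V) := by
    ext v
    rw [SimpleGraph.ConnectedComponent.mem_supp_iff, SimpleGraph.ConnectedComponent.eq, Finset.mem_coe]
    constructor
    · rintro ⟨w⟩
      exact hw u v w.reverse (by simp [hN])
    · intro hv
      by_cases h : v = u
      · rw [h]
      · exact (hcl v hv u (by simp [hN]) h).reachable
  refine hcomp (G.connectedComponentMk u) ⟨?_, ?_⟩
  · rw [hsupp, Set.ncard_coe_finset, hNc]
  · rw [hsupp]
    intro a ha b hb
    exact hcl a ha b hb

end helpers

theorem stmt3 [Fintype V] [DecidableEq V] (G : SimpleGraph V) [DecidableRel G.Adj]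
    (h6 : 6 ≤ Fintype.card V)
    (hlow : Fintype.card V + 1 ≤ 3 * G.maxDegree)
    (hhigh : 2 * G.maxDegree < Fintype.card V)
    (hcomp : ∀ K : G.ConnectedComponent,
      ¬ (K.supp.ncard = G.maxDegree + 1 ∧
         ∀ u ∈ K.supp, ∀ v ∈ K.supp, u ≠ v → G.Adj u v)) :
    ∀ (P : Finset (Finset V)) (r s t : ℕ), IsMaxRST G P r s t →
      r + s + t ≤ G.maxDegree := by
  intro P r s t hP
  by_contra hgt
  obtain ⟨hM, hn⟩ := fromRST hP
  have hdeg : ∀ v, G.degree v + 1 ≤ r + s + t := by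
    intro v
    have := G.degree_le_maxDegree v
    omega
  have hnk : ∀ u, G.degree u + 1 = r + s + t → ∃ p q, G.Adj u p ∧ G.Adj u q ∧ p ≠ q ∧ ¬ G.Adj p q := by
    intro u hu
    refine nk hcomp ?_
    have := G.degree_le_maxDegree u
    omega
  rcases Nat.lt_or_ge t 2 with ht | ht
  · interval_cases t
    · exact case_t0 hn hdeg (by omega) hM hnk
    · exact case_t1 hn hdeg (by omega) (by omega) hM hnk
  · exact case_t2 hM hn hdeg ht hnk
end

section
/- Every finite simple graph G admits an equitable proper coloring with Δ(G)+1 colors; consequently the equitable chromatic threshold satisfies χ=*(G) ≤ Δ(G)+1. -/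
open Finset

variable {V : Type*}

namespace HS
open Classical Relation

variable {α : Type*}

noncomputable def cls (U : Finset V) (f : V → α) (c : α) : Finset V := U.filter (fun v => f v = c)

noncomputable def nb (G : SimpleGraph V) (X : Finset V) (v : V) : Finset V := X.filter (fun w => G.Adj v w)

def Pr (G : SimpleGraph V) (U : Finset V) (f : V → α) : Prop :=
  ∀ u ∈ U, ∀ v ∈ U, G.Adj u v → f u ≠ f v

def EqC (G : SimpleGraph V) (U : Finset V) (C : Finset α) (s : ℕ) : Prop :=
  ∃ f : V → α, (∀ v ∈ U, f v ∈ C) ∧ Pr G U f ∧ ∀ c ∈ C, (cls U f c).card = s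

theorem mem_cls {U : Finset V} {f : V → α} {c : α} {v : V} : v ∈ cls U f c ↔ v ∈ U ∧ f v = c := by
  simp [cls]

theorem mem_nb {G : SimpleGraph V} {X : Finset V} {v w : V} : w ∈ nb G X v ↔ w ∈ X ∧ G.Adj v w := by
  simp [nb]

def Av (R : α → α → Prop) (u : α) (a b : α) : Prop := R a b ∧ a ≠ u ∧ b ≠ u

theorem last_exit {R : α → α → Prop} {a b : α} (h : ReflTransGen R a b) (hne : a ≠ b) :
    ∃ c, R a c ∧ c ≠ a ∧ ReflTransGen (Av R a) c b := by
  have key : ∀ x, ReflTransGen R x b → (x ≠ a ∧ ReflTransGen (Av R a) x b) ∨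
      ∃ c, R a c ∧ c ≠ a ∧ ReflTransGen (Av R a) c b := by
    intro x hx
    induction hx using ReflTransGen.head_induction_on with
    | refl => exact Or.inl ⟨hne.symm, .refl⟩
    | @head x y hxy _ ih =>
      rcases ih with ⟨h1, h2⟩ | h
      · by_cases hxa : x = a
        · subst hxa
          exact Or.inr ⟨_, hxy, h1, h2⟩
        · exact Or.inl ⟨hxa, .head ⟨hxy, hxa, h1⟩ h2⟩
      · exact Or.inr h
  rcases key a h with h | h
  · exact absurd rfl h.1
  · exact h

theorem card_ins {U : Finset V} {f : V → α} {v : V} (hv : v ∉ U) (c d : α) :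
    (cls (insert v U) (Function.update f v c) d).card = (cls U f d).card + if d = c then 1 else 0 := by
  have h : ∀ w ∈ U, Function.update f v c w = f w := by
    intro w hw
    rw [Function.update_of_ne]
    rintro rfl; exact hv hw
  have h2 : U.filter (fun w => Function.update f v c w = d) = U.filter (fun w => f w = d) :=
    Finset.filter_congr (fun w hw => by rw [h w hw])
  unfold cls
  rw [Finset.filter_insert, h2]
  by_cases hd : d = c
  · subst hd; simp [hv]
  · simp [hd, Ne.symm hd]

theorem card_era {U : Finset V} {f : V → α} {v : V} (hv : v ∈ U) (d : α) :
    (cls (U.erase v) f d).card + (if d = f v then 1 else 0) = (cls U f d).card := by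
  unfold cls
  rw [Finset.filter_erase]
  split_ifs with h
  · subst h
    exact Finset.card_erase_add_one (by simp [hv])
  · rw [Finset.erase_eq_of_notMem]
    · rfl
    · simp [Ne.symm h]

theorem Pr.mono {G : SimpleGraph V} {U U' : Finset V} {f : V → α} (h : Pr G U f) (hU : U' ⊆ U) :
    Pr G U' f := fun u hu v hv => h u (hU hu) v (hU hv)

theorem Pr.ins {G : SimpleGraph V} {U : Finset V} {f : V → α} {v : V} {c : α} (h : Pr G U f) (hv : v ∉ U)
    (hc : ∀ w ∈ U, f w = c → ¬ G.Adj v w) : Pr G (insert v U) (Function.update f v c) := by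
  have h' : ∀ w ∈ U, Function.update f v c w = f w := by
    intro w hw
    rw [Function.update_of_ne]
    rintro rfl; exact hv hw
  intro x hx y hy hxy
  rcases Finset.mem_insert.1 hx with hx1 | hx1 <;> rcases Finset.mem_insert.1 hy with hy1 | hy1
  · rw [hx1, hy1] at hxy
    exact absurd hxy (G.loopless.irrefl _)
  · rw [hx1, h' y hy1, Function.update_self]
    exact fun e => hc y hy1 e.symm (hx1 ▸ hxy)
  · rw [hy1, h' x hx1, Function.update_self]
    exact fun e => hc x hx1 e (hy1 ▸ hxy.symm)
  · rw [h' x hx1, h' y hy1]; exact h x hx1 y hy1 hxy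

theorem Pr.move {G : SimpleGraph V} {U : Finset V} {f : V → α} {v : V} {c : α} (h : Pr G U f) (hv : v ∈ U)
    (hc : ∀ w ∈ U, f w = c → ¬ G.Adj v w) : Pr G U (Function.update f v c) := by
  have := Pr.ins (v := v) (c := c) (h.mono (Finset.erase_subset v U)) (Finset.notMem_erase v U)
    (fun w hw => hc w (Finset.mem_of_mem_erase hw))
  rwa [Finset.insert_erase hv] at this

theorem card_move {U : Finset V} {f : V → α} {v : V} (hv : v ∈ U) (c d : α) :
    (cls U (Function.update f v c) d).card + (if d = f v then 1 else 0) =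
      (cls U f d).card + if d = c then 1 else 0 := by
  have h1 := card_ins (f := f) (Finset.notMem_erase v U) c d
  rw [Finset.insert_erase hv] at h1
  have h2 := card_era (f := f) hv d
  omega

theorem shift {G : SimpleGraph V} {U : Finset V} {f : V → α} (hf : Pr G U f) (S : Finset α) :
    ∀ (R : α → α → Prop) (a b : α), (∀ x y, R x y → x ∈ S ∧ y ∈ S) →
    (∀ x y, R x y → ∃ v ∈ U, f v = x ∧ ∀ w ∈ U, f w = y → ¬ G.Adj v w) →
    ReflTransGen R a b →
    ∃ f' : V → α, Pr G U f' ∧ (∀ v ∈ U, f' v = f v ∨ (f v ∈ S ∧ f' v ∈ S)) ∧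
      (∀ v ∈ U, f' v = a → f v = a) ∧
      ∀ c, (cls U f' c).card + (if c = a then 1 else 0) =
        (cls U f c).card + (if c = b then 1 else 0) := by
  induction S using Finset.strongInduction with
  | H S ih =>
    intro R a b hS hR hab
    by_cases hne : a = b
    · subst hne
      exact ⟨f, hf, fun v _ => Or.inl rfl, fun v _ h => h, fun c => rfl⟩
    obtain ⟨c, hac, hca, hcb⟩ := last_exit hab hne
    have haS := (hS _ _ hac).1
    have hcS := (hS _ _ hac).2
    obtain ⟨f', h1, h2, h3, h4⟩ := ih (S.erase a) (Finset.erase_ssubset haS) (Av R a) c b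
      (fun x y h => ⟨Finset.mem_erase.2 ⟨h.2.1, (hS _ _ h.1).1⟩, Finset.mem_erase.2 ⟨h.2.2, (hS _ _ h.1).2⟩⟩)
      (fun x y h => hR x y h.1) hcb
    obtain ⟨v, hv, hva, hvc⟩ := hR _ _ hac
    have hv' : f' v = a := by
      rcases h2 v hv with h | h
      · rw [h, hva]
      · exact absurd hva (Finset.mem_erase.1 h.1).1
    refine ⟨Function.update f' v c, h1.move hv (fun w hw hwc => hvc w hw (h3 w hw hwc)), ?_, ?_, ?_⟩
    · intro w hw
      by_cases hwv : w = v
      · subst hwv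
        right
        rw [Function.update_self, hva]
        exact ⟨haS, hcS⟩
      · rw [Function.update_of_ne hwv]
        rcases h2 w hw with h | h
        · exact Or.inl h
        · exact Or.inr ⟨Finset.mem_of_mem_erase h.1, Finset.mem_of_mem_erase h.2⟩
    · intro w hw
      by_cases hwv : w = v
      · subst hwv
        intro _; exact hva
      · rw [Function.update_of_ne hwv]
        intro hwa
        rcases h2 w hw with h | h
        · rw [← h, hwa]
        · exact absurd hwa (Finset.mem_erase.1 h.2).1
    · intro d
      have h5 := card_move (f := f') hv c d
      have h6 := h4 d
      rw [hv'] at h5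
      omega

theorem glue {G : SimpleGraph V} {U1 U2 : Finset V} {C1 C2 : Finset α} {f1 f2 : V → α}
    (hU : Disjoint U1 U2) (hC : Disjoint C1 C2)
    (h1 : ∀ v ∈ U1, f1 v ∈ C1) (h2 : ∀ v ∈ U2, f2 v ∈ C2) (p1 : Pr G U1 f1) (p2 : Pr G U2 f2) :
    ∃ g : V → α, (∀ v ∈ U1, g v = f1 v) ∧ (∀ v ∈ U2, g v = f2 v) ∧ Pr G (U1 ∪ U2) g ∧
      (∀ c ∈ C1, cls (U1 ∪ U2) g c = cls U1 f1 c) ∧ (∀ c ∈ C2, cls (U1 ∪ U2) g c = cls U2 f2 c) := by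
  have e1 : ∀ v ∈ U1, (if v ∈ U1 then f1 v else f2 v) = f1 v := fun v hv => by simp [hv]
  have e2 : ∀ v ∈ U2, (if v ∈ U1 then f1 v else f2 v) = f2 v := fun v hv => by
    have := Finset.disjoint_right.1 hU hv
    simp [this]
  generalize hg : (fun v => if v ∈ U1 then f1 v else f2 v) = g at *
  have e1 : ∀ v ∈ U1, g v = f1 v := fun v hv => by rw [← hg]; exact e1 v hv
  have e2 : ∀ v ∈ U2, g v = f2 v := fun v hv => by rw [← hg]; exact e2 v hv
  have hC' := Finset.disjoint_left.1 hC
  refine ⟨g, e1, e2, ?_, ?_, ?_⟩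
  · intro x hx y hy hxy
    rcases Finset.mem_union.1 hx with hx | hx <;> rcases Finset.mem_union.1 hy with hy | hy
    · rw [e1 x hx, e1 y hy]; exact p1 x hx y hy hxy
    · rw [e1 x hx, e2 y hy]; exact fun e => hC' (h1 x hx) (e ▸ h2 y hy)
    · rw [e2 x hx, e1 y hy]; exact fun e => hC' (h1 y hy) (e ▸ h2 x hx)
    · rw [e2 x hx, e2 y hy]; exact p2 x hx y hy hxy
  · intro c hc
    ext v
    rw [mem_cls, mem_cls, Finset.mem_union]
    constructor
    · rintro ⟨h | h, h'⟩
      · exact ⟨h, by rw [← e1 v h, h']⟩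
      · exact absurd (h2 v h) (by rw [← e2 v h, h']; exact hC' hc)
    · rintro ⟨h, h'⟩
      exact ⟨Or.inl h, by rw [e1 v h, h']⟩
  · intro c hc
    ext v
    rw [mem_cls, mem_cls, Finset.mem_union]
    constructor
    · rintro ⟨h | h, h'⟩
      · exact absurd hc (hC' (by rw [← h', e1 v h]; exact h1 v h))
      · exact ⟨h, by rw [← e2 v h, h']⟩
    · rintro ⟨h, h'⟩
      exact ⟨Or.inr h, by rw [e2 v h, h']⟩

theorem base [Nonempty α] (C : Finset α) (s : ℕ) : ∀ (U : Finset V), U.card = s * C.card → EqC (⊥ : SimpleGraph V) U C s := by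
  induction C using Finset.induction_on with
  | empty =>
    intro U hU
    have : U = ∅ := by simpa using hU
    subst this
    exact ⟨fun _ => Classical.arbitrary α, by simp, by simp [Pr], by simp⟩
  | insert c C hc ih =>
    intro U hU
    rw [Finset.card_insert_of_notMem hc] at hU
    obtain ⟨X, hX, hXs⟩ := Finset.exists_subset_card_eq (s := U) (n := s) (by rw [hU]; nlinarith)
    obtain ⟨f, f1, f2, f3⟩ := ih (U \ X) (by rw [Finset.card_sdiff_of_subset hX, hU, hXs, Nat.mul_succ]; omega)
    obtain ⟨g, g1, g2, g3, g4, g5⟩ := glue (G := ⊥) (U1 := X) (U2 := U \ X) (C1 := {c}) (C2 := C) (f1 := fun _ => c) (f2 := f)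
      Finset.disjoint_sdiff (by simpa using hc) (by simp) f1 (by simp [Pr]) f2
    rw [Finset.union_sdiff_of_subset hX] at *
    refine ⟨g, ?_, g3, ?_⟩
    · intro v hv
      by_cases hvX : v ∈ X
      · rw [g1 v hvX]; simp
      · rw [g2 v (by simp [hv, hvX])]
        exact Finset.mem_insert_of_mem (f1 v (by simp [hv, hvX]))
    · intro d hd
      rcases Finset.mem_insert.1 hd with rfl | hd
      · rw [g4 _ (by simp)]
        simp [cls, hXs]
      · rw [g5 d hd, f3 d hd]

theorem dc (G : SimpleGraph V) (X Y : Finset V) (w : V → ℕ) :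
    ∑ y ∈ Y, ∑ z ∈ nb G X y, w z = ∑ z ∈ X, w z * (nb G Y z).card := by
  unfold nb
  simp_rw [Finset.sum_filter]
  rw [Finset.sum_comm]
  refine Finset.sum_congr rfl fun z _ => ?_
  rw [← Finset.sum_filter, Finset.sum_const, smul_eq_mul, mul_comm]
  congr 2
  ext y; simp [G.adj_comm]

theorem W22 (G : SimpleGraph V) (W B : Finset V) (q s : ℕ) (hW : W.card = s) (hB : q * s + 1 ≤ B.card)
    (hone : ∀ y ∈ B, 1 ≤ (nb G W y).card)
    (hS : ∀ z ∈ W, (∃ y ∈ B, G.Adj z y ∧ (nb G W y).card = 1) → (nb G B z).card ≤ q)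
    (hD : ∀ z ∈ W, (nb G B z).card ≤ 2 * q) : False := by
  let w : V → ℕ := fun z => if (∃ y ∈ B, G.Adj z y ∧ (nb G W y).card = 1) then 2 else 1
  have h1 := dc G W B w
  have h2 : ∑ z ∈ W, w z * (nb G B z).card ≤ ∑ z ∈ W, 2 * q := by
    refine Finset.sum_le_sum fun z hz => ?_
    simp only [w]
    split_ifs with h
    · have := hS z hz h; omega
    · have := hD z hz; omega
  have h3 : ∑ y ∈ B, 2 ≤ ∑ y ∈ B, ∑ z ∈ nb G W y, w z := by
    refine Finset.sum_le_sum fun y hy => ?_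
    by_cases h : (nb G W y).card = 1
    · obtain ⟨z, hz⟩ := Finset.card_eq_one.1 h
      have hz' : z ∈ nb G W y := by rw [hz]; simp
      rw [hz, Finset.sum_singleton]
      have : (∃ y ∈ B, G.Adj z y ∧ (nb G W y).card = 1) := ⟨y, hy, (mem_nb.1 hz').2.symm, h⟩
      simp only [w, if_pos this]; rfl
    · have : ∑ z ∈ nb G W y, 1 ≤ ∑ z ∈ nb G W y, w z :=
        Finset.sum_le_sum fun z _ => by simp only [w]; split_ifs <;> omega
      have h5 := hone y hy
      simp only [Finset.sum_const, smul_eq_mul, mul_one] at this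
      omega
  simp only [Finset.sum_const, smul_eq_mul, hW] at h2 h3
  nlinarith

theorem cliq (G : SimpleGraph V) (A B : Finset V) (t s q : ℕ) (hA : A.card = t * s) (hB : q * s + 1 ≤ B.card)
    (hqt : q ≤ t) (sol : V → V → Prop) (hq : ∀ y ∈ B, (nb G B y).card < q)
    (hs : ∀ y ∈ B, t + (nb G B y).card + 1 ≤ q + (A.filter (fun z => sol z y)).card) :
    ∃ z ∈ A, ∃ y1 ∈ B, ∃ y2 ∈ B, y1 ≠ y2 ∧ ¬ G.Adj y1 y2 ∧ sol z y1 ∧ sol z y2 := by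
  by_contra hcon
  push Not at hcon
  let F := B.powerset.filter (fun I => ∀ x ∈ I, ∀ y ∈ I, ¬ G.Adj x y)
  obtain ⟨I, hIF, hmax⟩ := F.exists_max_image Finset.card ⟨∅, by simp [F]⟩
  simp only [F, Finset.mem_filter, Finset.mem_powerset] at hIF hmax
  obtain ⟨hIB, hI⟩ := hIF
  have hcov : B ⊆ I.biUnion (fun y => insert y (nb G B y)) := by
    intro x hx
    by_contra hx'
    simp only [Finset.mem_biUnion, Finset.mem_insert, mem_nb, not_exists, not_and, not_or] at hx'
    have hxI : x ∉ I := fun h => (hx' x h).1 rfl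
    have := hmax (insert x I) ⟨Finset.insert_subset hx hIB, by
      intro a ha b hb
      rcases Finset.mem_insert.1 ha with ha1 | ha1 <;> rcases Finset.mem_insert.1 hb with hb1 | hb1
      · rw [ha1, hb1]; exact G.loopless.irrefl _
      · rw [ha1]; exact fun h => (hx' b hb1).2 hx h.symm
      · rw [hb1]; exact (hx' a ha1).2 hx
      · exact hI a ha1 b hb1⟩
    rw [Finset.card_insert_of_notMem hxI] at this
    omega
  have h1 : B.card ≤ ∑ y ∈ I, ((nb G B y).card + 1) :=
    (Finset.card_le_card hcov).trans (Finset.card_biUnion_le.trans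
      (Finset.sum_le_sum fun y _ => Finset.card_insert_le _ _))
  have h2 : ∑ y ∈ I, ((nb G B y).card + 1) ≤ ∑ y ∈ I, q :=
    Finset.sum_le_sum fun y hy => hq y (hIB hy)
  have h3 : ∑ y ∈ I, (t + ((nb G B y).card + 1)) ≤ ∑ y ∈ I, (q + (A.filter (fun z => sol z y)).card) :=
    Finset.sum_le_sum fun y hy => hs y (hIB hy)
  have h4 : ∑ y ∈ I, (A.filter (fun z => sol z y)).card ≤ A.card := by
    have : ∑ y ∈ I, (A.filter (fun z => sol z y)).card = ∑ z ∈ A, (I.filter (fun y => sol z y)).card := by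
      simp_rw [Finset.card_filter]
      rw [Finset.sum_comm]
    rw [this, Finset.card_eq_sum_ones]
    refine Finset.sum_le_sum fun z hz => ?_
    rw [Finset.card_le_one]
    intro a ha b hb
    rw [Finset.mem_filter] at ha hb
    by_contra hne
    exact hcon z hz a (hIB ha.1) b (hIB hb.1) hne (hI a ha.1 b hb.1) ha.2 hb.2
  simp only [Finset.sum_add_distrib, Finset.sum_const, smul_eq_mul] at h1 h2 h3
  obtain ⟨r, rfl⟩ := Nat.exists_eq_add_of_le hqt
  have h5 : s < I.card := by
    by_contra h
    push Not at h
    have : I.card * q ≤ s * q := Nat.mul_le_mul_right _ h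
    nlinarith
  have h6 : r * s ≤ r * I.card := Nat.mul_le_mul_left _ h5.le
  nlinarith

theorem block (R : α → α → Prop) (A : Finset α) (n : α) (hn : n ∈ A)
    (hA : ∀ c ∈ A, ReflTransGen R c n) (h2 : ∃ c ∈ A, c ≠ n) :
    ∃ u ∈ A, ∃ T ⊆ A, T.Nonempty ∧ u ∉ T ∧ n ∉ T ∧
      (∀ W ∈ T, ∀ c ∈ A, c ≠ W → ReflTransGen (Av R W) c n) ∧
      (∀ W ∈ T, ∀ c ∈ A, c ∉ T → c ≠ u → ¬ R W c) := by
  let bl : α → Finset α := fun u => A.filter (fun c => c ≠ u ∧ ¬ ReflTransGen (Av R u) c n)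
  have mbl : ∀ u c, c ∈ bl u ↔ c ∈ A ∧ c ≠ u ∧ ¬ ReflTransGen (Av R u) c n := by
    intro u c; simp [bl]
  have hne : (A.filter (fun u => (bl u).Nonempty)).Nonempty := by
    obtain ⟨c, hc, hcn⟩ := h2
    refine ⟨n, Finset.mem_filter.2 ⟨hn, c, (mbl _ _).2 ⟨hc, hcn, fun h => ?_⟩⟩⟩
    rcases ReflTransGen.cases_tail h with h | ⟨d, _, h⟩
    · exact hcn h.symm
    · exact h.2.2 rfl
  obtain ⟨u, hu, hmin⟩ := Finset.exists_min_image _ (fun u => (bl u).card) hne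
  obtain ⟨huA, hu⟩ := Finset.mem_filter.1 hu
  refine ⟨u, huA, bl u, Finset.filter_subset _ _, hu, fun h => ((mbl _ _).1 h).2.1 rfl,
    fun h => ((mbl _ _).1 h).2.2 .refl, ?_, ?_⟩
  · intro W hW
    obtain ⟨hWA, hWu, hWr⟩ := (mbl _ _).1 hW
    by_contra hcon
    push Not at hcon
    obtain ⟨c, hc, hcW, hcr⟩ := hcon
    have h1 := hmin W (Finset.mem_filter.2 ⟨hWA, c, (mbl _ _).2 ⟨hc, hcW, hcr⟩⟩)
    have key : ∀ x, ReflTransGen (Av R u) x n → ReflTransGen (Av R W) x n := by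
      intro x hx
      induction hx using ReflTransGen.head_induction_on with
      | refl => exact .refl
      | @head x y hxy hy ih =>
        refine .head ⟨hxy.1, ?_, ?_⟩ ih
        · rintro rfl; exact hWr (.head hxy hy)
        · rintro rfl; exact hWr hy
    have h3 : bl W ⊆ (bl u).erase W := by
      intro x hx
      obtain ⟨hxA, hxW, hxr⟩ := (mbl _ _).1 hx
      refine Finset.mem_erase.2 ⟨hxW, (mbl _ _).2 ⟨hxA, ?_, fun h => hxr (key x h)⟩⟩
      rintro rfl
      by_cases hxn : x = n
      · subst hxn; exact hxr .refl
      · obtain ⟨d, hd, hdx, hdr⟩ := last_exit (hA x hxA) hxn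
        refine hxr (.head ⟨hd, hxW, ?_⟩ (key d hdr))
        rintro rfl; exact hWr hdr
    have h4 := Finset.card_le_card h3
    have h5 := Finset.card_erase_lt_of_mem hW
    omega
  · intro W hW c hc hcT hcu hR
    obtain ⟨hWA, hWu, hWr⟩ := (mbl _ _).1 hW
    refine hWr (.head ⟨hR, hWu, hcu⟩ ?_)
    by_contra h
    exact hcT ((mbl _ _).2 ⟨hc, hcu, h⟩)

theorem sum_cls (U : Finset V) (f : V → α) (T : Finset α) :
    (U.filter (fun v => f v ∈ T)).card = ∑ c ∈ T, (cls U f c).card := by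
  rw [Finset.card_eq_sum_card_fiberwise (f := f) (t := T) (by intro x hx; simpa using (Finset.mem_filter.1 hx).2)]
  refine Finset.sum_congr rfl fun c hc => ?_
  congr 1
  ext v
  simp only [Finset.mem_filter, mem_cls]
  constructor
  · rintro ⟨⟨h, _⟩, h'⟩; exact ⟨h, h'⟩
  · rintro ⟨h, h'⟩; exact ⟨⟨h, h' ▸ hc⟩, h'⟩

theorem sum_nb (G : SimpleGraph V) (U : Finset V) (f : V → α) (T : Finset α) (v : V) :
    (nb G (U.filter (fun v => f v ∈ T)) v).card = ∑ c ∈ T, (nb G (cls U f c) v).card := by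
  have h := sum_cls (nb G U v) f T
  have e1 : nb G (U.filter (fun v => f v ∈ T)) v = (nb G U v).filter (fun v => f v ∈ T) := by
    unfold nb; rw [Finset.filter_comm]
  have e2 : ∀ c, nb G (cls U f c) v = cls (nb G U v) f c := by
    intro c; unfold nb cls; rw [Finset.filter_comm]
  simp_rw [e1, e2, h]

theorem free (G : SimpleGraph V) (X : Finset V) (h : V → α) (C : Finset α) (z : V)
    (hc : (nb G X z).card < C.card) : ∃ c ∈ C, ∀ w ∈ X, h w = c → ¬ G.Adj z w := by
  have : ((nb G X z).image h).card < C.card := Finset.card_image_le.trans_lt hc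
  obtain ⟨c, hcC, hc'⟩ := Finset.exists_mem_notMem_of_card_lt_card this
  refine ⟨c, hcC, fun w hw hwc hadj => hc' ?_⟩
  exact Finset.mem_image.2 ⟨w, mem_nb.2 ⟨hw, hadj⟩, hwc⟩

def Rel (G : SimpleGraph V) (U : Finset V) (C : Finset α) (f : V → α) (a b : α) : Prop :=
  b ∈ C ∧ ∃ v ∈ U, f v = a ∧ ∀ w ∈ U, f w = b → ¬ G.Adj v w

noncomputable def acc (G : SimpleGraph V) (U : Finset V) (C : Finset α) (f : V → α) (n : α) : Finset α :=
  C.filter (fun c => ReflTransGen (Rel G U C f) c n)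

theorem nb_mono (G : SimpleGraph V) {X Y : Finset V} (h : X ⊆ Y) (v : V) : (nb G X v).card ≤ (nb G Y v).card :=
  Finset.card_le_card (Finset.filter_subset_filter _ h)

theorem case1 {G : SimpleGraph V} {U : Finset V} {C : Finset α} {s : ℕ} {f : V → α} {n : α}
    {AA : Finset α} {A B : Finset V} (hAA : AA ⊆ C) (hA : A = U.filter (fun v => f v ∈ AA))
    (hB : B = U.filter (fun v => f v ∉ AA)) (hf : Pr G U f)
    (hcard : ∀ c ∈ AA, (cls U f c).card + (if c = n then 1 else 0) = s)
    {R : α → α → Prop} (hR : ∀ x y, R x y → x ∈ AA ∧ y ∈ AA ∧ Rel G U C f x y)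
    {z y : V} {W X : α} (hz : z ∈ U) (hzW : f z = W) (hW : W ∈ AA) (hX : X ∈ AA) (hXW : X ≠ W)
    (hy : y ∈ B) (hzX : ∀ w ∈ U, f w = X → ¬ G.Adj z w) (hadj : G.Adj z y)
    (hsolo : (nb G (cls U f W) y).card = 1) (hr : ReflTransGen (Av R W) X n)
    (IHB : EqC G (B.erase y) (C \ AA) s) : EqC G U C s := by
  have memA : ∀ v, v ∈ A ↔ v ∈ U ∧ f v ∈ AA := by intro v; simp [hA]
  have memB : ∀ v, v ∈ B ↔ v ∈ U ∧ f v ∉ AA := by intro v; simp [hB]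
  have hyA : y ∉ A := fun h => ((memB y).1 hy).2 ((memA y).1 h).2
  have clsA : ∀ c ∈ AA, cls A f c = cls U f c := by
    intro c hc; ext v; rw [mem_cls, mem_cls, memA]
    constructor
    · rintro ⟨⟨h, _⟩, h'⟩; exact ⟨h, h'⟩
    · rintro ⟨h, h'⟩; exact ⟨⟨h, h' ▸ hc⟩, h'⟩
  have hAU : A ⊆ U := fun v hv => ((memA v).1 hv).1
  have only : ∀ w ∈ U, f w = W → G.Adj y w → w = z := by
    intro w hw hwW hyw
    exact Finset.card_le_one.1 hsolo.le w (mem_nb.2 ⟨mem_cls.2 ⟨hw, hwW⟩, hyw⟩) z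
      (mem_nb.2 ⟨mem_cls.2 ⟨hz, hzW⟩, hadj.symm⟩)
  obtain ⟨f', p1, p2, p3, p4⟩ := shift (hf.mono hAU) (AA.erase W) (Av R W) X n
    (fun x y h => ⟨Finset.mem_erase.2 ⟨h.2.1, (hR _ _ h.1).1⟩, Finset.mem_erase.2 ⟨h.2.2, (hR _ _ h.1).2.1⟩⟩)
    (fun x y h => by
      obtain ⟨hx, hy, _, v, hv, hvx, hvy⟩ := hR _ _ h.1
      exact ⟨v, (memA v).2 ⟨hv, hvx ▸ hx⟩, hvx, fun w hw => hvy w (hAU hw)⟩) hr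
  have hzA : z ∈ A := (memA z).2 ⟨hz, hzW ▸ hW⟩
  have hz' : f' z = W := by
    rcases p2 z hzA with h | h
    · rw [h, hzW]
    · exact absurd hzW (Finset.mem_erase.1 h.1).1
  have hfA : ∀ v ∈ A, f' v ∈ AA := by
    intro v hv
    rcases p2 v hv with h | h
    · rw [h]; exact ((memA v).1 hv).2
    · exact Finset.mem_of_mem_erase h.2
  have hfW : ∀ v ∈ A, f' v = W → f v = W := by
    intro v hv hvW
    rcases p2 v hv with h | h
    · rw [← h, hvW]
    · exact absurd hvW (Finset.mem_erase.1 h.2).1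
  have q1 : Pr G A (Function.update f' z X) :=
    p1.move hzA (fun w hw hwX => hzX w (hAU hw) (p3 w hw hwX))
  have q2 : Pr G (insert y A) (Function.update (Function.update f' z X) y W) := by
    refine q1.ins hyA ?_
    intro w hw hwW hyw
    by_cases hwz : w = z
    · subst hwz
      rw [Function.update_self] at hwW
      exact hXW hwW
    · rw [Function.update_of_ne hwz] at hwW
      exact hwz (only w (hAU hw) (hfW w hw hwW) hyw)
  obtain ⟨h, h1, h2, h3⟩ := IHB
  obtain ⟨g, g1, g2, g3, g4, g5⟩ := glue (G := G) (U1 := insert y A) (U2 := B.erase y) (C1 := AA) (C2 := C \ AA)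
    (f1 := Function.update (Function.update f' z X) y W) (f2 := h)
    (by
      rw [Finset.disjoint_left]
      intro v hv hv'
      rcases Finset.mem_insert.1 hv with hv | hv
      · exact (Finset.mem_erase.1 hv').1 hv
      · exact ((memB v).1 (Finset.mem_of_mem_erase hv')).2 ((memA v).1 hv).2)
    Finset.disjoint_sdiff
    (by
      intro v hv
      by_cases hvy : v = y
      · subst hvy; rw [Function.update_self]; exact hW
      · rw [Function.update_of_ne hvy]
        by_cases hvz : v = z
        · subst hvz; rw [Function.update_self]; exact hX
        · rw [Function.update_of_ne hvz]
          exact hfA v (Finset.mem_of_mem_insert_of_ne hv hvy))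
    h1 q2 h2
  have hU : insert y A ∪ B.erase y = U := by
    ext v
    rw [Finset.mem_union, Finset.mem_insert, Finset.mem_erase, memA, memB]
    have := ((memB y).1 hy).1
    by_cases hvy : v = y
    · subst hvy; simp [this]
    · by_cases hv : f v ∈ AA <;> simp [hvy, hv]
  rw [hU] at g3 g4 g5
  have cs : ∀ c ∈ C, (cls U g c).card = s := by
    intro c hc
    by_cases hcA : c ∈ AA
    · rw [g4 c hcA]
      have e1 := card_ins (f := Function.update f' z X) hyA W c
      have e2 := card_move (f := f') hzA X c
      have e3 := p4 c
      have e4 := hcard c hcA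
      rw [clsA c hcA] at e3
      rw [hz'] at e2
      omega
    · rw [g5 c (by simp [hc, hcA]), h3 c (by simp [hc, hcA])]
  refine ⟨g, ?_, g3, cs⟩
  intro v hv
  by_cases hvm : v ∈ insert y A
  · rw [g1 v hvm]
    apply hAA
    by_cases hvy : v = y
    · subst hvy; rw [Function.update_self]; exact hW
    · rw [Function.update_of_ne hvy]
      by_cases hvz : v = z
      · subst hvz; rw [Function.update_self]; exact hX
      · rw [Function.update_of_ne hvz]
        exact hfA v (Finset.mem_of_mem_insert_of_ne hvm hvy)
  · have : v ∈ B.erase y := by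
      rw [← hU] at hv
      exact (Finset.mem_union.1 hv).resolve_left hvm
    rw [g2 v this]
    exact (Finset.mem_sdiff.1 (h1 v this)).1

theorem case2 {G : SimpleGraph V} {U : Finset V} {C : Finset α} {s : ℕ} {f : V → α} {n : α}
    {AA : Finset α} {A B : Finset V} (hAA : AA ⊆ C) (hA : A = U.filter (fun v => f v ∈ AA))
    (hB : B = U.filter (fun v => f v ∉ AA)) (hf : Pr G U f) (hn : n ∈ AA)
    (hcard : ∀ c ∈ AA, (cls U f c).card + (if c = n then 1 else 0) = s)
    {R : α → α → Prop} (hR : ∀ x y, R x y → x ∈ AA ∧ y ∈ AA ∧ Rel G U C f x y)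
    {z y y2 : V} {W : α} (hz : z ∈ U) (hzW : f z = W) (hW : W ∈ AA) (hWn : W ≠ n)
    (hWr : ReflTransGen R W n)
    (hr : ∀ c ∈ AA, c ≠ W → ReflTransGen (Av R W) c n)
    (hzX : ∀ X ∈ AA, X ≠ W → ∃ w ∈ U, f w = X ∧ G.Adj z w)
    (hy : y ∈ B) (hadj : G.Adj z y) (hsolo : (nb G (cls U f W) y).card = 1)
    (hy2 : y2 ∈ B) (hadj2 : G.Adj z y2) (hsolo2 : (nb G (cls U f W) y2).card = 1)
    (hne : y ≠ y2) (hnadj : ¬ G.Adj y y2)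
    (hdz : (nb G (B.erase y) z).card < (C \ AA).card)
    (IHB : EqC G (B.erase y) (C \ AA) s) :
    ∃ g : V → α, ∃ p ∈ C, (∀ v ∈ U, g v ∈ C) ∧ Pr G U g ∧
      (∀ c ∈ C, (cls U g c).card + (if c = n then 1 else 0) = s + (if c = p then 1 else 0)) ∧
      (C \ acc G U C g n).card < (C \ AA).card := by
  have memA : ∀ v, v ∈ A ↔ v ∈ U ∧ f v ∈ AA := by intro v; simp [hA]
  have memB : ∀ v, v ∈ B ↔ v ∈ U ∧ f v ∉ AA := by intro v; simp [hB]
  have hyA : y ∉ A := fun h => ((memB y).1 hy).2 ((memA y).1 h).2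
  have clsA : ∀ c ∈ AA, cls A f c = cls U f c := by
    intro c hc; ext v; rw [mem_cls, mem_cls, memA]
    constructor
    · rintro ⟨⟨h, _⟩, h'⟩; exact ⟨h, h'⟩
    · rintro ⟨h, h'⟩; exact ⟨⟨h, h' ▸ hc⟩, h'⟩
  have hAU : A ⊆ U := fun v hv => ((memA v).1 hv).1
  have hzA : z ∈ A := (memA z).2 ⟨hz, hzW ▸ hW⟩
  have hzB : z ∉ B := fun h => ((memB z).1 h).2 (hzW ▸ hW)
  have hyz : y ≠ z := fun h => hyA (h ▸ hzA)
  have only : ∀ y, G.Adj z y → (nb G (cls U f W) y).card = 1 → ∀ w ∈ U, f w = W → G.Adj y w → w = z := by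
    intro y hadj hsolo w hw hwW hyw
    exact Finset.card_le_one.1 hsolo.le w (mem_nb.2 ⟨mem_cls.2 ⟨hw, hwW⟩, hyw⟩) z
      (mem_nb.2 ⟨mem_cls.2 ⟨hz, hzW⟩, hadj.symm⟩)
  obtain ⟨h, h1, h2, h3⟩ := IHB
  obtain ⟨Y, hYC, hY⟩ := free G (B.erase y) h (C \ AA) z hdz
  have hyAe : y ∉ A.erase z := fun h => hyA (Finset.mem_of_mem_erase h)
  have hzBe : z ∉ B.erase y := fun h => hzB (Finset.mem_of_mem_erase h)
  have q1 : Pr G (insert y (A.erase z)) (Function.update f y W) := by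
    refine (hf.mono ((Finset.erase_subset _ _).trans hAU)).ins hyAe ?_
    intro w hw hwW hyw
    exact (Finset.mem_erase.1 hw).1 (only y hadj hsolo w (hAU (Finset.mem_of_mem_erase hw)) hwW hyw)
  have q2 : Pr G (insert z (B.erase y)) (Function.update h z Y) := h2.ins hzBe hY
  have m1 : ∀ v ∈ insert y (A.erase z), Function.update f y W v ∈ AA := by
    intro v hv
    by_cases hvy : v = y
    · subst hvy; rw [Function.update_self]; exact hW
    · rw [Function.update_of_ne hvy]
      exact ((memA v).1 (Finset.mem_of_mem_erase (Finset.mem_of_mem_insert_of_ne hv hvy))).2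
  have m2 : ∀ v ∈ insert z (B.erase y), Function.update h z Y v ∈ C \ AA := by
    intro v hv
    by_cases hvy : v = z
    · subst hvy; rw [Function.update_self]; exact hYC
    · rw [Function.update_of_ne hvy]
      exact h1 v (Finset.mem_of_mem_insert_of_ne hv hvy)
  obtain ⟨g, g1, g2, g3, g4, g5⟩ := glue (G := G) (C1 := AA) (C2 := C \ AA)
    (by
      rw [Finset.disjoint_left]
      intro v hv hv'
      rcases Finset.mem_insert.1 hv with hv | hv <;> rcases Finset.mem_insert.1 hv' with hv' | hv'
      · exact hyz (hv ▸ hv')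
      · exact (Finset.mem_erase.1 hv').1 hv
      · exact (Finset.mem_erase.1 hv).1 hv'
      · exact ((memB v).1 (Finset.mem_of_mem_erase hv')).2 ((memA v).1 (Finset.mem_of_mem_erase hv)).2)
    Finset.disjoint_sdiff m1 m2 q1 q2
  have hU : insert y (A.erase z) ∪ insert z (B.erase y) = U := by
    ext v
    rw [Finset.mem_union, Finset.mem_insert, Finset.mem_insert, Finset.mem_erase, Finset.mem_erase, memA, memB]
    have := ((memB y).1 hy).1
    by_cases hvy : v = y
    · subst hvy; simp [this]
    · by_cases hvz : v = z
      · subst hvz; simp [hz]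
      · by_cases hv : f v ∈ AA <;> simp [hvy, hvz, hv]
  rw [hU] at g3 g4 g5
  have gW : ∀ w ∈ U, g w ∈ AA → w = y ∨ (w ∈ A ∧ w ≠ z ∧ g w = f w) := by
    intro w hw hgw
    have h1 : w ∈ cls U g (g w) := mem_cls.2 ⟨hw, rfl⟩
    rw [g4 _ hgw, mem_cls] at h1
    rcases Finset.mem_insert.1 h1.1 with e | e
    · exact Or.inl e
    · refine Or.inr ⟨Finset.mem_of_mem_erase e, (Finset.mem_erase.1 e).1, ?_⟩
      rw [← h1.2, Function.update_of_ne]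
      rintro rfl; exact hyAe e
  have gy : g y = W := by
    rw [g1 y (Finset.mem_insert_self _ _), Function.update_self]
  have gA : ∀ v ∈ A, v ≠ z → g v = f v := by
    intro v hv hvz
    rw [g1 v (Finset.mem_insert_of_mem (Finset.mem_erase.2 ⟨hvz, hv⟩)), Function.update_of_ne]
    rintro rfl; exact hyA hv
  have tr : ∀ a b, b ≠ W → R a b → Rel G U C g a b := by
    intro a b hbW hab
    obtain ⟨haA, hbA, hbC, v, hv, hva, hvb⟩ := hR a b hab
    have hvz : v ≠ z := by
      rintro rfl
      obtain ⟨w, hw, hwb, hadj⟩ := hzX b hbA hbW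
      exact hvb w hw hwb hadj
    have hvA : v ∈ A := (memA v).2 ⟨hv, hva ▸ haA⟩
    refine ⟨hbC, v, hv, by rw [gA v hvA hvz, hva], ?_⟩
    intro w hw hwb
    rcases gW w hw (hwb ▸ hbA) with e | ⟨e1, e2, e3⟩
    · subst e; exact absurd (hwb.symm.trans gy) hbW
    · exact hvb w hw (by rw [← e3, hwb])
  have tr2 : ∀ c, ReflTransGen (Av R W) c n → ReflTransGen (Rel G U C g) c n :=
    fun c hc => ReflTransGen.mono (fun a b (hab : Av R W a b) => tr a b hab.2.2 hab.1) _ _ hc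
  have rW : ReflTransGen (Rel G U C g) W n := by
    obtain ⟨c, hc1, hc2, hc3⟩ := last_exit hWr hWn
    exact .head (tr _ _ hc2 hc1) (tr2 c hc3)
  have hy2B : y2 ∈ B.erase y := Finset.mem_erase.2 ⟨hne.symm, hy2⟩
  have gy2 : g y2 = h y2 := by
    rw [g2 y2 (Finset.mem_insert_of_mem hy2B), Function.update_of_ne]
    rintro rfl; exact hzB hy2
  have r2 : ReflTransGen (Rel G U C g) (h y2) n := by
    refine .head ⟨hAA hW, y2, ((memB y2).1 hy2).1, gy2, ?_⟩ rW
    intro w hw hwW hadjw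
    rcases gW w hw (hwW ▸ hW) with e | ⟨e1, e2, e3⟩
    · subst e; exact hnadj hadjw.symm
    · exact e2 (only y2 hadj2 hsolo2 w hw (by rw [← e3, hwW]) hadjw)
  refine ⟨g, Y, (Finset.mem_sdiff.1 hYC).1, ?_, g3, ?_, ?_⟩
  · intro v hv
    rw [← hU] at hv
    rcases Finset.mem_union.1 hv with hv | hv
    · rw [g1 v hv]; exact hAA (m1 v hv)
    · rw [g2 v hv]; exact (Finset.mem_sdiff.1 (m2 v hv)).1
  · intro c hc
    by_cases hcA : c ∈ AA
    · have hcY : c ≠ Y := by rintro rfl; exact (Finset.mem_sdiff.1 hYC).2 hcA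
      rw [g4 c hcA]
      have e1 := card_ins (f := f) hyAe W c
      have e2 := card_era (f := f) hzA c
      have e4 := hcard c hcA
      rw [clsA c hcA, hzW] at e2
      rw [if_neg hcY]
      omega
    · have hcn : c ≠ n := by rintro rfl; exact hcA hn
      have hcC : c ∈ C \ AA := by simp [hc, hcA]
      rw [g5 c hcC, card_ins hzBe, h3 c hcC, if_neg hcn]
      omega
  · have hh := h1 y2 hy2B
    refine Finset.card_lt_card ⟨?_, ?_⟩
    · intro c hc
      rw [Finset.mem_sdiff] at hc ⊢
      refine ⟨hc.1, fun hcA => hc.2 ?_⟩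
      refine Finset.mem_filter.2 ⟨hc.1, ?_⟩
      by_cases hcW : c = W
      · rw [hcW]; exact rW
      · exact tr2 c (hr c hcA hcW)
    · intro hsub
      have := hsub hh
      exact (Finset.mem_sdiff.1 this).2 (Finset.mem_filter.2 ⟨(Finset.mem_sdiff.1 hh).1, r2⟩)

theorem near {G : SimpleGraph V} {U : Finset V} {C : Finset α} {s : ℕ}
    (hdeg : ∀ v ∈ U, (nb G U v).card < C.card)
    (IH : ∀ B, B ⊂ U → ∀ C' : Finset α, B.card = s * C'.card → (∀ v ∈ B, (nb G B v).card < C'.card) →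
      EqC G B C' s) (N : ℕ) :
    ∀ (f : V → α) (p n : α), n ∈ C → p ∈ C → (∀ v ∈ U, f v ∈ C) → Pr G U f →
    (∀ c ∈ C, (cls U f c).card + (if c = n then 1 else 0) = s + (if c = p then 1 else 0)) →
    (C \ acc G U C f n).card < N → EqC G U C s := by
  induction N with
  | zero => intro f p n _ _ _ _ _ h; omega
  | succ N ihN =>
  intro f p n hn hp hfC hf hcard hN
  have relC : ∀ x y, Rel G U C f x y → x ∈ C ∧ y ∈ C := by
    rintro x y ⟨hy, v, hv, rfl, _⟩
    exact ⟨hfC v hv, hy⟩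
  by_cases hpn : ReflTransGen (Rel G U C f) p n
  · obtain ⟨f', p1, p2, p3, p4⟩ := shift hf C (Rel G U C f) p n relC (fun x y h => h.2) hpn
    refine ⟨f', ?_, p1, ?_⟩
    · intro v hv
      rcases p2 v hv with h | h
      · rw [h]; exact hfC v hv
      · exact h.2
    · intro c hc
      have := p4 c
      have := hcard c hc
      omega
  obtain ⟨AA, hAAdef⟩ : ∃ AA, AA = acc G U C f n := ⟨_, rfl⟩
  rw [← hAAdef] at hN
  have memAA : ∀ c, c ∈ AA ↔ c ∈ C ∧ ReflTransGen (Rel G U C f) c n := by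
    intro c; rw [hAAdef]; simp [acc]
  have hAA : AA ⊆ C := fun c hc => ((memAA c).1 hc).1
  have hnA : n ∈ AA := (memAA n).2 ⟨hn, .refl⟩
  have hpA : p ∉ AA := fun h => hpn ((memAA p).1 h).2
  have hcardA : ∀ c ∈ AA, (cls U f c).card + (if c = n then 1 else 0) = s := by
    intro c hc
    have := hcard c (hAA hc)
    rwa [if_neg (show c ≠ p from fun h => hpA (h ▸ hc))] at this
  have hcardB : ∀ c ∈ C \ AA, (cls U f c).card = s + (if c = p then 1 else 0) := by
    intro c hc
    have := hcard c (Finset.mem_sdiff.1 hc).1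
    rwa [if_neg (show c ≠ n from fun h => (Finset.mem_sdiff.1 hc).2 (h ▸ hnA))] at this
  obtain ⟨A, hA⟩ : ∃ A, A = U.filter (fun v => f v ∈ AA) := ⟨_, rfl⟩
  obtain ⟨B, hB⟩ : ∃ B, B = U.filter (fun v => f v ∉ AA) := ⟨_, rfl⟩
  have memA : ∀ v, v ∈ A ↔ v ∈ U ∧ f v ∈ AA := by intro v; simp [hA]
  have memB : ∀ v, v ∈ B ↔ v ∈ U ∧ f v ∉ AA := by intro v; simp [hB]
  have hBU : B ⊆ U := fun v hv => ((memB v).1 hv).1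
  have hB2 : B = U.filter (fun v => f v ∈ C \ AA) := by
    ext v; rw [memB, Finset.mem_filter, Finset.mem_sdiff]
    constructor
    · rintro ⟨h, h'⟩; exact ⟨h, hfC v h, h'⟩
    · rintro ⟨h, _, h'⟩; exact ⟨h, h'⟩
  have cA : A.card + 1 = AA.card * s := by
    have : ∑ c ∈ AA, ((cls U f c).card + (if c = n then 1 else 0)) = ∑ c ∈ AA, s :=
      Finset.sum_congr rfl hcardA
    rw [Finset.sum_add_distrib, ← sum_cls, ← hA, Finset.sum_const, smul_eq_mul] at this
    simpa [hnA] using this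
  have cB : B.card = (C \ AA).card * s + 1 := by
    have hp' : p ∈ C \ AA := Finset.mem_sdiff.2 ⟨hp, hpA⟩
    rw [hB2, sum_cls, Finset.sum_congr rfl hcardB, Finset.sum_add_distrib, Finset.sum_const, smul_eq_mul,
      Finset.sum_ite_eq', if_pos hp']
  have ck : (C \ AA).card + AA.card = C.card := Finset.card_sdiff_add_card_eq_card hAA
  have hAnb : ∀ v, (nb G A v).card = ∑ c ∈ AA, (nb G (cls U f c) v).card := by
    intro v; rw [hA]; exact sum_nb G U f AA v
  have hsplit : ∀ v, (nb G U v).card = (nb G A v).card + (nb G B v).card := by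
    intro v
    have := Finset.card_filter_add_card_filter_not (s := nb G U v) (fun w => f w ∈ AA)
    rw [← this, hA, hB]
    unfold nb
    congr 2 <;> exact Finset.filter_comm _ _ _
  have hone : ∀ y ∈ B, ∀ c ∈ AA, 1 ≤ (nb G (cls U f c) y).card := by
    intro y hy c hc
    by_contra hcon
    have h0 : nb G (cls U f c) y = ∅ := by
      rw [← Finset.card_eq_zero]; omega
    obtain ⟨hyU, hyA⟩ := (memB y).1 hy
    apply hyA
    refine (memAA _).2 ⟨hfC y hyU, .head ⟨hAA hc, y, hyU, rfl, ?_⟩ ((memAA c).1 hc).2⟩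
    intro w hw hwc hadj
    have : w ∈ nb G (cls U f c) y := mem_nb.2 ⟨mem_cls.2 ⟨hw, hwc⟩, hadj⟩
    rw [h0] at this
    simp at this
  have lb : ∀ v, ∀ T ⊆ AA, (∀ c ∈ T, 1 ≤ (nb G (cls U f c) v).card) → T.card ≤ (nb G A v).card := by
    intro v T hT h
    rw [hAnb, Finset.card_eq_sum_ones]
    exact (Finset.sum_le_sum h).trans (Finset.sum_le_sum_of_subset hT)
  have hdB : ∀ y ∈ B, (nb G B y).card < (C \ AA).card := by
    intro y hy
    have h1 := lb y AA (Finset.Subset.refl _) (hone y hy)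
    have h2 := hsplit y
    have h3 := hdeg y (hBU hy)
    omega
  have IHB : ∀ y ∈ B, EqC G (B.erase y) (C \ AA) s := by
    intro y hy
    refine IH _ ((Finset.erase_ssubset hy).trans_subset hBU) _ ?_ ?_
    · rw [Finset.card_erase_of_mem hy, cB, mul_comm]; rfl
    · intro v hv
      exact (nb_mono G (Finset.erase_subset _ _) v).trans_lt (hdB v (Finset.mem_of_mem_erase hv))
  have h2A : ∃ c ∈ AA, c ≠ n := by
    by_contra hcon
    push Not at hcon
    have hAn : AA = {n} := by
      ext c; rw [Finset.mem_singleton]; exact ⟨hcon c, fun h => h ▸ hnA⟩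
    have h1 := dc G A B (fun _ => 1)
    have h2 : ∑ y ∈ B, 1 ≤ ∑ y ∈ B, ∑ z ∈ nb G A y, 1 := by
      refine Finset.sum_le_sum fun y hy => ?_
      have := lb y AA (Finset.Subset.refl _) (hone y hy)
      rw [hAn, Finset.card_singleton] at this
      simpa using this
    have h3 : ∑ z ∈ A, 1 * (nb G B z).card ≤ ∑ z ∈ A, (C \ AA).card := by
      refine Finset.sum_le_sum fun z hz => ?_
      have h2 := hsplit z
      have h3 := hdeg z ((memA z).1 hz).1
      rw [hAn, Finset.card_singleton] at ck
      rw [hAn]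
      omega
    rw [h1] at h2
    have h4 := h2.trans h3
    simp only [Finset.sum_const, smul_eq_mul, mul_one] at h4
    rw [hAn, Finset.card_singleton, one_mul] at cA
    rw [cB, ← cA] at h4
    nlinarith
  obtain ⟨R, hRdef⟩ : ∃ R : α → α → Prop, R = fun a b => a ∈ AA ∧ b ∈ AA ∧ Rel G U C f a b := ⟨_, rfl⟩
  have hR : ∀ x y, R x y → x ∈ AA ∧ y ∈ AA ∧ Rel G U C f x y := by
    intro x y h; rw [hRdef] at h; exact h
  have hRA : ∀ c ∈ AA, ReflTransGen R c n := by
    intro c hc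
    have := ((memAA c).1 hc).2
    induction this using ReflTransGen.head_induction_on with
    | refl => exact .refl
    | @head x y hxy hy ih =>
      have hyA : y ∈ AA := (memAA y).2 ⟨(relC _ _ hxy).2, hy⟩
      refine .head ?_ (ih hyA)
      rw [hRdef]; exact ⟨hc, hyA, hxy⟩
  obtain ⟨u, huA, T, hTA, hTne, huT, hnT, hterm, hnomove⟩ := block R AA n hnA hRA h2A
  by_cases hc1 : ∃ z ∈ U, f z ∈ T ∧ ∃ y ∈ B, G.Adj z y ∧ (nb G (cls U f (f z)) y).card = 1 ∧
      ∃ X ∈ AA, X ≠ f z ∧ ∀ w ∈ U, f w = X → ¬ G.Adj z w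
  · obtain ⟨z, hz, hzT, y, hy, hadj, hsolo, X, hX, hXz, hzX⟩ := hc1
    exact case1 hAA hA hB hf hcardA hR hz rfl (hTA hzT) hX hXz hy hzX hadj hsolo
      (hterm _ hzT X hX hXz) (IHB y hy)
  push Not at hc1
  have hzdeg : ∀ z ∈ U, f z ∈ T → ∀ y ∈ B, G.Adj z y → (nb G (cls U f (f z)) y).card = 1 →
      (nb G B z).card ≤ (C \ AA).card := by
    intro z hz hzT y hy hadj hsolo
    have h1 := lb z (AA.erase (f z)) (Finset.erase_subset _ _) (by
      intro c hc
      obtain ⟨w, hw, hwc, hzw⟩ := hc1 z hz hzT y hy hadj hsolo c (Finset.mem_of_mem_erase hc) (Finset.mem_erase.1 hc).1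
      exact Finset.card_pos.2 ⟨w, mem_nb.2 ⟨mem_cls.2 ⟨hw, hwc⟩, hzw⟩⟩)
    have h2 := hsplit z
    have h3 := hdeg z hz
    rw [Finset.card_erase_of_mem (hTA hzT)] at h1
    omega
  have cT : ∀ c ∈ T, (cls U f c).card = s := by
    intro c hc
    have := hcardA c (hTA hc)
    rwa [if_neg (show c ≠ n from fun h => hnT (h ▸ hc))] at this
  have hqt : (C \ AA).card < T.card := by
    by_contra hcon
    push Not at hcon
    obtain ⟨W, hW⟩ := hTne
    refine W22 G (cls U f W) B (C \ AA).card s (cT W hW) cB.ge (fun y hy => hone y hy W (hTA hW)) ?_ ?_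
    · rintro z hz ⟨y, hy, hadj, hsolo⟩
      obtain ⟨hzU, rfl⟩ := mem_cls.1 hz
      exact hzdeg z hzU hW y hy hadj hsolo
    · intro z hz
      obtain ⟨hzU, rfl⟩ := mem_cls.1 hz
      have h1 := lb z ((AA \ T).erase u) ((Finset.erase_subset _ _).trans Finset.sdiff_subset) (by
        intro c hc
        obtain ⟨hcu, hc⟩ := Finset.mem_erase.1 hc
        obtain ⟨hcA, hcT⟩ := Finset.mem_sdiff.1 hc
        by_contra hcon2
        have h0 : nb G (cls U f c) z = ∅ := by
          rw [← Finset.card_eq_zero]; omega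
        apply hnomove _ hW c hcA hcT hcu
        rw [hRdef]
        refine ⟨hTA hW, hcA, hAA hcA, z, hzU, rfl, ?_⟩
        intro w hw hwc hadj
        have : w ∈ nb G (cls U f c) z := mem_nb.2 ⟨mem_cls.2 ⟨hw, hwc⟩, hadj⟩
        rw [h0] at this
        simp at this)
      have h2 := hsplit z
      have h3 := hdeg z hzU
      rw [Finset.card_erase_of_mem (Finset.mem_sdiff.2 ⟨huA, huT⟩), Finset.card_sdiff_of_subset hTA] at h1
      omega
  obtain ⟨z, hzA', y, hy, y2, hy2, hne, hnadj, ⟨hadj, hsolo⟩, hadj2, hsolo2⟩ :=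
    cliq G (U.filter (fun v => f v ∈ T)) B T.card s (C \ AA).card
      (by rw [sum_cls, Finset.sum_congr rfl cT, Finset.sum_const, smul_eq_mul]) cB.ge hqt.le
      (fun z y => G.Adj z y ∧ (nb G (cls U f (f z)) y).card = 1) hdB (by
        intro y hy
        have h1 : ∀ c ∈ T, 2 ≤ (nb G (cls U f c) y).card +
            (cls (U.filter (fun z => G.Adj z y ∧ (nb G (cls U f (f z)) y).card = 1)) f c).card := by
          intro c hc
          have h1 := hone y hy c (hTA hc)
          by_cases h2 : (nb G (cls U f c) y).card = 1
          · obtain ⟨z, hz⟩ := Finset.card_pos.1 (show 0 < (nb G (cls U f c) y).card by omega)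
            obtain ⟨hz, hyz⟩ := mem_nb.1 hz
            obtain ⟨hzU, rfl⟩ := mem_cls.1 hz
            have : 0 < (cls (U.filter (fun z => G.Adj z y ∧ (nb G (cls U f (f z)) y).card = 1)) f (f z)).card :=
              Finset.card_pos.2 ⟨z, mem_cls.2 ⟨Finset.mem_filter.2 ⟨hzU, hyz.symm, h2⟩, rfl⟩⟩
            omega
          · omega
        have h2 := Finset.sum_le_sum h1
        rw [Finset.sum_add_distrib, ← sum_cls, Finset.sum_const, smul_eq_mul, Finset.filter_comm] at h2
        have h3 : ∑ c ∈ AA \ T, 1 ≤ ∑ c ∈ AA \ T, (nb G (cls U f c) y).card :=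
          Finset.sum_le_sum fun c hc => hone y hy c (Finset.mem_sdiff.1 hc).1
        rw [← Finset.card_eq_sum_ones, Finset.card_sdiff_of_subset hTA] at h3
        have h4 := Finset.sum_sdiff (f := fun c => (nb G (cls U f c) y).card) hTA
        rw [← hAnb] at h4
        have h5 := hsplit y
        have h6 := hdeg y (hBU hy)
        have h7 := Finset.card_le_card hTA
        have h8 : T.card + (nb G B y).card + 1 ≤ (C \ AA).card + ((U.filter (fun v => f v ∈ T)).filter
            (fun z => G.Adj z y ∧ (nb G (cls U f (f z)) y).card = 1)).card := by omega
        convert h8)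
  obtain ⟨hz, hzT⟩ := Finset.mem_filter.1 hzA'
  obtain ⟨g, p', hp', k1, k2, k3, k4⟩ := case2 hAA hA hB hf hnA hcardA hR hz rfl (hTA hzT)
    (fun h => hnT (h ▸ hzT)) (hRA _ (hTA hzT)) (hterm _ hzT)
    (hc1 z hz hzT y hy hadj hsolo) hy hadj hsolo hy2 hadj2 hsolo2 hne hnadj
    (by
      have h1 := hzdeg z hz hzT y hy hadj hsolo
      refine lt_of_lt_of_le (Finset.card_lt_card ⟨?_, ?_⟩) h1
      · exact Finset.filter_subset_filter _ (Finset.erase_subset _ _)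
      · intro hsub
        have := hsub (mem_nb.2 ⟨hy, hadj⟩)
        exact Finset.notMem_erase y B (mem_nb.1 this).1)
    (IHB y hy)
  exact ihN g p' n hn hp' k1 k2 k3 (by omega)

def rs (G : SimpleGraph V) (T : Finset V) : SimpleGraph V where
  Adj a b := G.Adj a b ∧ a ∈ T ∧ b ∈ T
  symm := ⟨fun _ _ h => ⟨h.1.symm, h.2.2, h.2.1⟩⟩
  loopless := ⟨fun _ h => G.loopless.irrefl _ h.1⟩

theorem hs [Nonempty α] (s : ℕ) (m : ℕ) : ∀ (G : SimpleGraph V) (U : Finset V) (C : Finset α), U.card < m →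
    U.card = s * C.card → (∀ v ∈ U, (nb G U v).card < C.card) → EqC G U C s := by
  induction m with
  | zero => intro G U C h; omega
  | succ m ih =>
  intro G U C hm hU hdeg
  have key : ∀ T : Finset V, T ⊆ U → EqC (rs G T) U C s := by
    intro T
    induction T using Finset.induction_on with
    | empty =>
      intro _
      obtain ⟨f, h1, h2, h3⟩ := base C s U hU
      exact ⟨f, h1, fun u _ v _ h => absurd h.2.1 (by simp), h3⟩
    | insert u T hu ihT =>
      intro hT
      obtain ⟨f, h1, h2, h3⟩ := ihT ((Finset.subset_insert _ _).trans hT)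
      have huU : u ∈ U := hT (Finset.mem_insert_self _ _)
      have hdeg' : ∀ v ∈ U, (nb (rs G (insert u T)) U v).card < C.card := by
        intro v hv
        refine (Finset.card_le_card ?_).trans_lt (hdeg v hv)
        intro w hw
        obtain ⟨hw1, hw2⟩ := mem_nb.1 hw
        exact mem_nb.2 ⟨hw1, hw2.1⟩
      obtain ⟨c, hc, hcf⟩ := free (rs G (insert u T)) U f C u (hdeg' u huU)
      refine near hdeg' (fun B hB C' => ?_) ((C \ acc (rs G (insert u T)) U C (Function.update f u c) (f u)).card + 1)
        (Function.update f u c) c (f u) (h1 u huU) hc ?_ ?_ ?_ (Nat.lt_succ_self _)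
      · have := Finset.card_lt_card hB
        exact ih _ B C' (by omega)
      · intro v hv
        by_cases hvu : v = u
        · rw [hvu, Function.update_self]; exact hc
        · rw [Function.update_of_ne hvu]; exact h1 v hv
      · have e : Pr (rs G (insert u T)) (U.erase u) f := by
          intro x hx y hy hxy
          refine h2 x (Finset.mem_of_mem_erase hx) y (Finset.mem_of_mem_erase hy) ⟨hxy.1, ?_, ?_⟩
          · exact Finset.mem_of_mem_insert_of_ne hxy.2.1 (Finset.mem_erase.1 hx).1
          · exact Finset.mem_of_mem_insert_of_ne hxy.2.2 (Finset.mem_erase.1 hy).1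
        have := e.ins (Finset.notMem_erase u U) (c := c) (fun w hw => hcf w (Finset.mem_of_mem_erase hw))
        rwa [Finset.insert_erase huU] at this
      · intro d hd
        rw [card_move huU, h3 d hd]
  obtain ⟨f, h1, h2, h3⟩ := key U (Finset.Subset.refl _)
  exact ⟨f, h1, fun u hu v hv h => h2 u hu v hv ⟨h, hu, hv⟩, h3⟩

theorem final [Fintype V] (G : SimpleGraph V) [DecidableRel G.Adj] (k : ℕ) (hk : G.maxDegree + 1 ≤ k) :
    EqColorable G k := by
  obtain ⟨s, hs'⟩ : ∃ s, s = Fintype.card V / k + 1 := ⟨_, rfl⟩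
  have hk0 : 0 < k := by omega
  have h1 : Fintype.card V ≤ s * k := by
    rw [hs']; have := Nat.lt_div_mul_add (a := Fintype.card V) hk0; nlinarith
  obtain ⟨p, hp⟩ := Nat.exists_eq_add_of_le h1
  have hpk : p ≤ k := by
    have := Nat.div_mul_le_self (Fintype.card V) k
    rw [hs', Nat.succ_mul] at hp; omega
  haveI : Nonempty (Fin k) := ⟨⟨0, hk0⟩⟩
  let G' : SimpleGraph (V ⊕ Fin p) := G ⊕g (⊤ : SimpleGraph (Fin p))
  obtain ⟨f, f1, f2, f3⟩ := hs (α := Fin k) s _ G' Finset.univ Finset.univ (Nat.lt_succ_self _)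
    (by simp [hp]) (by
      rintro (v | j) -
      · have : nb G' Finset.univ (Sum.inl v) = (G.neighborFinset v).map ⟨Sum.inl, Sum.inl_injective⟩ := by
          ext w
          rcases w with w | w <;> simp [mem_nb, G']
        rw [this, Finset.card_map, Finset.card_univ, Fintype.card_fin, G.card_neighborFinset_eq_degree]
        have := G.degree_le_maxDegree v
        omega
      · have : nb G' Finset.univ (Sum.inr j) = (Finset.univ.erase j).map ⟨Sum.inr, Sum.inr_injective⟩ := by
          ext w
          rcases w with w | w <;> simp [mem_nb, G', eq_comm]
        rw [this, Finset.card_map, Finset.card_erase_of_mem (Finset.mem_univ _)]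
        simp
        have := j.2
        omega)
  have h2 : ∀ i, (Finset.univ.filter fun v => f (Sum.inl v) = i).card ≤ s ∧
      s ≤ (Finset.univ.filter fun v => f (Sum.inl v) = i).card + 1 := by
    intro i
    have e : cls Finset.univ f i = (Finset.univ.filter fun v => f (Sum.inl v) = i).map ⟨Sum.inl, Sum.inl_injective⟩ ∪
        (Finset.univ.filter fun v => f (Sum.inr v) = i).map ⟨Sum.inr, Sum.inr_injective⟩ := by
      ext w
      rcases w with w | w <;> simp [mem_cls]
    have e1 := f3 i (Finset.mem_univ _)
    rw [e, Finset.card_union_of_disjoint (by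
      rw [Finset.disjoint_left]
      rintro (w | w) <;> simp), Finset.card_map, Finset.card_map] at e1
    have e2 : (Finset.univ.filter fun v => f (Sum.inr v) = i).card ≤ 1 := by
      rw [Finset.card_le_one]
      intro a ha b hb
      by_contra hab
      simp only [Finset.mem_filter, Finset.mem_univ, true_and] at ha hb
      exact f2 (Sum.inr a) (Finset.mem_univ _) (Sum.inr b) (Finset.mem_univ _) (by simpa [G'] using hab) (ha.trans hb.symm)
    omega
  refine ⟨fun v => f (Sum.inl v), fun u v huv => f2 _ (Finset.mem_univ _) _ (Finset.mem_univ _) (by simpa [G'] using huv), ?_⟩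
  intro i j
  have hi := (h2 i).1
  have hj := (h2 j).2
  have := hi.trans hj
  convert this

end HS

theorem stmt19 [Fintype V] (G : SimpleGraph V) [DecidableRel G.Adj] :
    EqColorable G (G.maxDegree + 1) ∧
      ∀ k : ℕ, G.maxDegree + 1 ≤ k → EqColorable G k :=
  ⟨HS.final G _ le_rfl, fun k hk => HS.final G k hk⟩
end
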